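/- Let K be a quadratic field and let c ∈ K. Then there do not exist α, β ∈ K such that α has preperiodic type 1₂ under f_c and β has preperiodic type 2₂ under f_c. (In particular, G(f_c,K) contains no subgraph generated by a point of type 1₂, a fixed point, and a point of type 2₂.) -/

import Mathlib

/-- The quadratic map `z ↦ z ^ 2 + c`. -/
def fc {K : Type*} [Field K] (c : K) : K → K := fun z => z ^ 2 + c

/-- `α` has exact period `m` under `fc c`. -/
def HasExactPeriod {K : Type*} [Field K] (c : K) (m : ℕ) (α : K) : Prop :=
  (fc c)^[m] α = α ∧ ∀ j : ℕ, 1 ≤ j → j < m → (fc c)^[j] α ≠ α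

/-- `α` has preperiodic type `m_n` under `fc c`: preperiod exactly `n`, eventual period `m`. -/
def HasPreperiodicType {K : Type*} [Field K] (c : K) (m n : ℕ) (α : K) : Prop :=
  HasExactPeriod c m ((fc c)^[n] α) ∧ (fc c)^[n + m - 1] α ≠ (fc c)^[n - 1] α

theorem exists_four_factors {a b m n : ℤ} (ha : a ≠ 0) (h : a * b = m * n) :
    ∃ x y z w : ℤ, a = x * y ∧ b = z * w ∧ m = x * z ∧ n = y * w := by
  obtain ⟨x, y, ⟨z, rfl⟩, ⟨w, rfl⟩, rfl⟩ := exists_dvd_and_dvd_of_dvd_mul (Dvd.intro b h)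
  refine ⟨x, y, z, w, rfl, mul_left_cancel₀ ha ?_, rfl, rfl⟩
  linear_combination h

theorem exists_eq_mul_of_mul_eq {X Y A B : ℤ} (hX : X ≠ 0) (hXY : IsCoprime X Y)
    (h : X * A = Y * B) : ∃ k, A = k * Y ∧ B = k * X := by
  obtain ⟨k, rfl⟩ : X ∣ B := hXY.dvd_of_dvd_mul_left (Dvd.intro A h)
  exact ⟨k, mul_left_cancel₀ hX (by linear_combination h), mul_comm _ _⟩

theorem dvd_of_dvd_mul_sq {d n a b : ℤ} (hab : IsCoprime a b) (ha : d ∣ n * a ^ 2)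
    (hb : d ∣ n * b ^ 2) : d ∣ n := by
  obtain ⟨u, v, huv⟩ := hab.pow (m := 2) (n := 2)
  have := dvd_add (ha.mul_left u) (hb.mul_left v)
  rwa [show u * (n * a ^ 2) + v * (n * b ^ 2) = n by linear_combination n * huv] at this

theorem bounds_of_dvd {k n : ℤ} (hn : 0 < n) (h : k ∣ n) : -n ≤ k ∧ k ≤ n := by
  have h1 := Int.le_of_dvd hn h
  have h2 := Int.le_of_dvd hn (neg_dvd.2 h)
  omega

theorem Int.exists_sq_eq_of_odd {r : ℤ} (hr : Odd r) : ∃ j, r ^ 2 = 8 * j + 1 := by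
  obtain ⟨k, rfl⟩ := hr
  obtain ⟨j, hj⟩ := Int.even_mul_succ_self k
  exact ⟨j, by linear_combination 4 * hj⟩

theorem IsCoprime.odd_or_odd {a b : ℤ} (h : IsCoprime a b) : Odd a ∨ Odd b := by
  by_contra! hc
  simp only [Int.not_odd_iff_even] at hc
  obtain ⟨⟨x, rfl⟩, ⟨y, rfl⟩⟩ := hc
  obtain ⟨u, v, huv⟩ := h
  have : 2 * (u * x + v * y) = 1 := by linear_combination huv
  omega

theorem exists_sq_of_mul_eq_sq {a b c : ℤ} (h : IsCoprime a b) (ha : 0 ≤ a) (hc : a * b = c ^ 2) :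
    ∃ r, a = r ^ 2 := by
  obtain ⟨r, hr | hr⟩ := Int.sq_of_isCoprime h hc
  · exact ⟨r, hr⟩
  · exact ⟨0, by nlinarith [sq_nonneg r]⟩

theorem exists_sq_sq_of_mul_eq_sq {x y n : ℤ} (h : IsCoprime x y) (hpos : 0 ≤ x + y)
    (hn : x * y = n ^ 2) : ∃ P Q, x = P ^ 2 ∧ y = Q ^ 2 ∧ n = P * Q := by
  have hx : 0 ≤ x := by by_contra! hx; nlinarith [sq_nonneg n]
  have hy : 0 ≤ y := by by_contra! hy; nlinarith [sq_nonneg n]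
  obtain ⟨P, rfl⟩ := exists_sq_of_mul_eq_sq h hx hn
  obtain ⟨Q, rfl⟩ := exists_sq_of_mul_eq_sq h.symm hy ((mul_comm _ _).trans hn)
  rcases sq_eq_sq_iff_eq_or_eq_neg.1 (show n ^ 2 = (P * Q) ^ 2 by linear_combination -hn) with e | e
  · exact ⟨P, Q, rfl, rfl, e⟩
  · exact ⟨-P, Q, by ring, rfl, by linear_combination e⟩

/-- A primitive solution of `V ^ 2 - s ^ 2 = 4 * n ^ 2` is parametrised as for Pythagorean
triples. -/
theorem exists_param_of_sq_sub_sq {V s n : ℤ} (h : IsCoprime V s) (hV : Odd V) (hs : Odd s)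
    (hpos : 0 ≤ V) (hn : V ^ 2 - s ^ 2 = 4 * n ^ 2) :
    ∃ P Q, V = P ^ 2 + Q ^ 2 ∧ s = P ^ 2 - Q ^ 2 ∧ n = P * Q ∧ IsCoprime P Q := by
  obtain ⟨y, hy⟩ : Even (V - s) := hV.sub_odd hs
  obtain rfl : V = s + (y + y) := by linear_combination hy
  have hcop : IsCoprime (s + y) y := by
    obtain ⟨u, v, h⟩ := h
    exact ⟨u + v, u - v, by linear_combination h⟩
  obtain ⟨P, Q, hP, rfl, hPQ⟩ := exists_sq_sq_of_mul_eq_sq (x := s + y) (y := y) (n := n) hcop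
    (by linarith) (by linarith)
  rw [hP] at hcop
  exact ⟨P, Q, by linarith, by linarith, hPQ,
    (IsCoprime.pow_left_iff two_pos).1 ((IsCoprime.pow_right_iff two_pos).1 hcop)⟩

theorem exists_param_of_sq_sub_sq_prime {l V s n : ℤ} (hl : Prime l) (hl0 : 0 < l)
    (h : IsCoprime V s) (hV : Odd V) (hs : Odd s)
    (hpos : 0 ≤ V) (hn : V ^ 2 - s ^ 2 = 4 * l * n ^ 2) :
    ∃ P Q, V = l * P ^ 2 + Q ^ 2 ∧ (s = l * P ^ 2 - Q ^ 2 ∨ s = Q ^ 2 - l * P ^ 2) ∧ n = P * Q ∧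
      IsCoprime P Q := by
  obtain ⟨y, hy⟩ : Even (V - s) := hV.sub_odd hs
  obtain rfl : V = s + (y + y) := by linear_combination hy
  have hcop : IsCoprime (s + y) y := by
    obtain ⟨u, v, h⟩ := h
    exact ⟨u + v, u - v, by linear_combination h⟩
  have hprod : (s + y) * y = l * n ^ 2 := by linarith
  have key : ∀ {x y : ℤ}, IsCoprime x y → x * y = l * n ^ 2 → 0 ≤ x + y → l ∣ x →
      ∃ P Q, x = l * P ^ 2 ∧ y = Q ^ 2 ∧ n = P * Q ∧ IsCoprime P Q := by
    rintro x y hxy hmul hpos ⟨x, rfl⟩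
    have hmul' : x * y = n ^ 2 := mul_left_cancel₀ hl.ne_zero (by linear_combination hmul)
    have hxpos : 0 ≤ x + y := by
      by_contra! hneg
      have : 0 ≤ x * y := hmul' ▸ sq_nonneg n
      have hx : x < 0 ∨ y < 0 := by by_contra! hc; linarith
      rcases hx with hx | hx <;> nlinarith
    obtain ⟨P, Q, rfl, rfl, hPQ⟩ := exists_sq_sq_of_mul_eq_sq hxy.of_mul_left_right hxpos hmul'
    exact ⟨P, Q, rfl, rfl, hPQ, (IsCoprime.pow_left_iff two_pos).1
      ((IsCoprime.pow_right_iff two_pos).1 hxy.of_mul_left_right)⟩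
  rcases hl.dvd_or_dvd (Dvd.intro (n ^ 2) hprod.symm) with hd | hd
  · obtain ⟨P, Q, h1, h2, h3, h4⟩ := key hcop hprod (by linarith) hd
    exact ⟨P, Q, by linarith, Or.inl (by linarith), h3, h4⟩
  · obtain ⟨P, Q, h1, h2, h3, h4⟩ := key hcop.symm ((mul_comm _ _).trans hprod) (by linarith) hd
    exact ⟨P, Q, by linarith, Or.inr (by linarith), h3, h4⟩

theorem isCoprime_of_add_sub {m n : ℤ} (h : IsCoprime (m + n) (m - n)) : IsCoprime m n := by
  obtain ⟨u, v, h⟩ := h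
  exact ⟨u + v, u - v, by linear_combination h⟩

theorem smaller_state {x y z w : ℤ} (hyz : IsCoprime y z)
    (hy : Odd y) (hz : Odd z) (hxw0 : x * w ≠ 0)
    (h₁ : x ^ 2 - w ^ 2 = y * z) (h₂ : y ^ 2 - z ^ 2 = x * w) :
    ∃ a b m n : ℤ, IsCoprime a b ∧ IsCoprime m n ∧ a * b = m * n ∧
      m ^ 2 + n ^ 2 + a * b = a ^ 2 + b ^ 2 ∧ a * b ≠ 0 ∧
      (a * b).natAbs < (x * w * (y * z)).natAbs := by
  have hy0 : y ≠ 0 := by rintro rfl; simp at hy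
  have hz0 : z ≠ 0 := by rintro rfl; simp at hz
  obtain ⟨p, q, r, s, rfl, rfl, hpr, hqs⟩ :=
    exists_four_factors hy0 (show y * z = (x - w) * (x + w) by linear_combination -h₁)
  obtain ⟨hp, hq⟩ := Int.odd_mul.1 hy
  obtain ⟨hr, hs⟩ := Int.odd_mul.1 hz
  have hqr : IsCoprime q r := hyz.of_mul_left_right.of_mul_right_left
  have hps : IsCoprime p s := hyz.of_mul_left_left.of_mul_right_right
  obtain ⟨k, hk₁, hk₂⟩ := exists_eq_mul_of_mul_eq
    (pow_ne_zero 2 (left_ne_zero_of_mul hy0)) (hps.pow (n := 2))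
    (show p ^ 2 * (4 * q ^ 2 + r ^ 2) = s ^ 2 * (q ^ 2 + 4 * r ^ 2) by
      linear_combination 4 * h₂ + (x + w + q * s) * hqs - (x - w + p * r) * hpr)
  have hk : k ∣ 15 := dvd_of_dvd_mul_sq hqr ⟨4 * s ^ 2 - p ^ 2, by linear_combination 4 * hk₁ - hk₂⟩
    ⟨4 * p ^ 2 - s ^ 2, by linear_combination 4 * hk₂ - hk₁⟩
  have hk5 : k = 5 := by
    obtain ⟨h1, h2⟩ := bounds_of_dvd (by norm_num) hk
    obtain ⟨q', hq'⟩ := Int.exists_sq_eq_of_odd hq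
    obtain ⟨r', hr'⟩ := Int.exists_sq_eq_of_odd hr
    obtain ⟨s', hs'⟩ := Int.exists_sq_eq_of_odd hs
    rw [hq', hr', hs'] at hk₁
    obtain ⟨e, he⟩ := hk
    have hk0 : 0 < k := by
      by_contra! hneg
      have hq0 := sq_nonneg q
      have hr0 := sq_nonneg r
      have hks := mul_nonneg (neg_nonneg.2 hneg) (sq_nonneg s)
      rw [hs', neg_mul, ← hk₁] at hks
      omega
    interval_cases k <;> omega
  subst hk5
  obtain ⟨m, hm⟩ : Even (s - r) := hs.sub_odd hr
  obtain ⟨a, ha⟩ : Even (q - p) := hq.sub_odd hp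
  have h4r : IsCoprime (4 : ℤ) r := by
    obtain ⟨j, hj⟩ := Int.exists_sq_eq_of_odd hr
    exact ⟨-2 * j, r, by linear_combination hj⟩
  have h4q : IsCoprime (4 : ℤ) q := by
    obtain ⟨j, hj⟩ := Int.exists_sq_eq_of_odd hq
    exact ⟨-2 * j, q, by linear_combination hj⟩
  have hrs : IsCoprime r s := by
    have h : IsCoprime r (4 * q ^ 2 + r * r) :=
      (h4r.symm.mul_right hqr.symm.pow_right).add_mul_left_right r
    rw [show 4 * q ^ 2 + r * r = 5 * s * s by linear_combination hk₁] at h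
    exact h.of_mul_right_right
  have hqp : IsCoprime q p := by
    have h : IsCoprime q (4 * r ^ 2 + q * q) :=
      (h4q.symm.mul_right hqr.pow_right).add_mul_left_right q
    rw [show 4 * r ^ 2 + q * q = 5 * p * p by linear_combination hk₂] at h
    exact h.of_mul_right_right
  have hab : a * (a + p) = p ^ 2 - r ^ 2 := by
    obtain rfl : q = p + (a + a) := by linear_combination ha
    linarith
  have hmn : m * (m + r) = p ^ 2 - r ^ 2 := by
    obtain rfl : s = r + (m + m) := by linear_combination hm
    linarith
  have hxw : x * w = a * (a + p) * (r ^ 2 + q ^ 2) := by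
    rw [hab, ← h₂]
    have e1 : s ^ 2 = r ^ 2 + 4 * (p ^ 2 - r ^ 2) := by linarith
    have e2 : q ^ 2 = r ^ 2 + 5 * (p ^ 2 - r ^ 2) := by linarith
    rw [mul_pow, mul_pow, e1, e2]; ring
  refine ⟨a, a + p, m, m + r, ?_, ?_, by rw [hab, hmn], ?_, ?_, ?_⟩
  · obtain ⟨u, v, h⟩ := hqp
    exact ⟨u - v, u + v, by linear_combination h - u * ha⟩
  · obtain ⟨u, v, h⟩ := hrs
    exact ⟨v - u, v + u, by linear_combination h - v * hm⟩
  · linear_combination 2 * hmn - hab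
  · exact left_ne_zero_of_mul (hxw ▸ hxw0)
  · rw [hxw, mul_assoc, Int.natAbs_mul (a * (a + p))]
    have h0 : 0 < (a * (a + p)).natAbs := Int.natAbs_pos.2 (left_ne_zero_of_mul (hxw ▸ hxw0))
    refine lt_mul_of_one_lt_right h0 ?_
    rw [Int.natAbs_mul]
    have : 0 < (p * q * (r * s)).natAbs := Int.natAbs_pos.2 (mul_ne_zero hy0 hz0)
    have hr2 : 1 ≤ r ^ 2 := by
      have := sq_pos_of_ne_zero (left_ne_zero_of_mul hz0); omega
    have hq2 : 1 ≤ q ^ 2 := by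
      have := sq_pos_of_ne_zero (right_ne_zero_of_mul hy0); omega
    have : 2 ≤ (r ^ 2 + q ^ 2).natAbs := by omega
    nlinarith

theorem isCoprime_mul_sq_sub_sq {y z : ℤ} (h : IsCoprime y z) :
    IsCoprime (y * z) (y ^ 2 - z ^ 2) := by
  refine IsCoprime.mul_left ?_ ?_
  · have := (h.pow_right (n := 2)).neg_right.add_mul_left_right y
    rwa [show -z ^ 2 + y * y = y ^ 2 - z ^ 2 by ring] at this
  · have := (h.symm.pow_right (n := 2)).add_mul_left_right (-z)
    rwa [show y ^ 2 + z * -z = y ^ 2 - z ^ 2 by ring] at this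

theorem mul_eq_zero_of_state (N : ℕ) : ∀ {a b m n : ℤ}, (a * b).natAbs = N → IsCoprime a b →
    IsCoprime m n → a * b = m * n → m ^ 2 + n ^ 2 + a * b = a ^ 2 + b ^ 2 → a * b = 0 := by
  induction N using Nat.strong_induction_on with
  | _ N ih =>
  intro a b m n hN hab hmn h₁ h₂
  by_contra h0
  obtain ⟨x, y, z, w, rfl, rfl, rfl, rfl⟩ := exists_four_factors (left_ne_zero_of_mul h0) h₁
  have hyz : IsCoprime y z := hab.of_mul_left_right.of_mul_right_left
  have hxw : IsCoprime x w := hab.of_mul_left_left.of_mul_right_right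
  have hyw : IsCoprime y w := hab.of_mul_left_right.of_mul_right_right
  have hxz : IsCoprime x z := hab.of_mul_left_left.of_mul_right_left
  have hxy : IsCoprime x y := hmn.of_mul_left_left.of_mul_right_left
  have hzw : IsCoprime z w := hmn.of_mul_left_right.of_mul_right_right
  have key : (x ^ 2 - w ^ 2) * (y ^ 2 - z ^ 2) = x * w * (y * z) := by linear_combination -h₂
  obtain ⟨k, hk⟩ : y * z ∣ x ^ 2 - w ^ 2 :=
    (isCoprime_mul_sq_sub_sq hyz).dvd_of_dvd_mul_right ⟨x * w, by linear_combination key⟩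
  have hyz0 : y * z ≠ 0 := by
    intro h; apply h0; linear_combination x * w * h
  have hk' : x * w = k * (y ^ 2 - z ^ 2) := by
    apply mul_left_cancel₀ hyz0
    linear_combination -key + (y ^ 2 - z ^ 2) * hk
  have hu : IsUnit k :=
    (isCoprime_mul_sq_sub_sq hxw).isUnit_of_dvd' ⟨_, hk'⟩ ⟨y * z, by rw [hk, mul_comm]⟩
  have step : ∀ {x y z w : ℤ}, IsCoprime y z → Odd y → Odd z → x * w ≠ 0 →
      (x * w * (y * z)).natAbs = N → x ^ 2 - w ^ 2 = y * z → y ^ 2 - z ^ 2 = x * w → False := by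
    intro x y z w hyz hy hz hxw0 hN h₁ h₂
    obtain ⟨a, b, m, n, c₁, c₂, e₁, e₂, n0, hlt⟩ := smaller_state hyz hy hz hxw0 h₁ h₂
    exact n0 (ih _ (hN ▸ hlt) rfl c₁ c₂ e₁ e₂)
  have hxw0 : x * w ≠ 0 := by
    intro h; apply h0; linear_combination y * z * h
  have main : ∀ {x y z w : ℤ}, IsCoprime y z → IsCoprime x y → IsCoprime x z → IsCoprime y w →
      IsCoprime z w → IsCoprime x w → y * z ≠ 0 → x * w ≠ 0 →
      (x * w * (y * z)).natAbs = N → x ^ 2 - w ^ 2 = y * z → y ^ 2 - z ^ 2 = x * w → False := by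
    intro x y z w hyz hxy hxz hyw hzw hxw hyz0 hxw0 hN h₁ h₂
    by_cases hodd : Odd y ∧ Odd z
    · exact step hyz hodd.1 hodd.2 hxw0 hN h₁ h₂
    · have hx : Odd x := by
        have := hxy.odd_or_odd; have := hxz.odd_or_odd; tauto
      have hw : Odd w := by
        have := hyw.odd_or_odd; have := hzw.odd_or_odd; tauto
      exact step hxw hx hw hyz0 (by rw [← hN, mul_comm]) h₂ h₁
  rcases Int.isUnit_iff.1 hu with rfl | rfl
  · exact main hyz hxy hxz hyw hzw hxw hyz0 hxw0 (by rw [← hN]; congr 1; ring)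
      (by linear_combination hk) (by linear_combination -hk')
  · refine main (x := -x) (y := -y) (z := z) (w := w) hyz.neg_left hxy.neg_neg hxz.neg_left
      hyw.neg_left hzw hxw.neg_left (by simpa using hyz0) (by simpa using hxw0)
      (by rw [← hN]; congr 1; ring) (by linear_combination hk) (by linear_combination hk')

theorem odd_sq_add_mul_add_sq {a b : ℤ} (h : IsCoprime a b) : Odd (a ^ 2 + a * b + b ^ 2) := by
  rcases h.odd_or_odd with ha | hb
  · have : Even (b * (a + b)) := by
      rcases Int.even_or_odd b with hb | hb
      · exact hb.mul_right _
      · exact (ha.add_odd hb).mul_left _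
    rw [show a ^ 2 + a * b + b ^ 2 = a ^ 2 + b * (a + b) by ring]
    exact ha.pow.add_even this
  · have : Even (a * (a + b)) := by
      rcases Int.even_or_odd a with ha | ha
      · exact ha.mul_right _
      · exact (ha.add_odd hb).mul_left _
    rw [show a ^ 2 + a * b + b ^ 2 = a * (a + b) + b ^ 2 by ring]
    exact this.add_odd hb.pow

theorem isCoprime_two_of_odd {r : ℤ} (hr : Odd r) : IsCoprime r 2 := by
  obtain ⟨k, rfl⟩ := hr
  exact ⟨1, -k, by ring⟩

theorem isCoprime_quadratic_mul {a b : ℤ} (h : IsCoprime a b) (k : ℤ) :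
    IsCoprime (a ^ 2 + k * a * b + b ^ 2) (a * b) := by
  refine IsCoprime.mul_right ?_ ?_
  · have := ((h.pow_right (n := 2)).add_mul_left_right (a + k * b)).symm
    rwa [show b ^ 2 + a * (a + k * b) = a ^ 2 + k * a * b + b ^ 2 by ring] at this
  · have := ((h.symm.pow_right (n := 2)).add_mul_left_right (b + k * a)).symm
    rwa [show a ^ 2 + b * (b + k * a) = a ^ 2 + k * a * b + b ^ 2 by ring] at this

theorem isCoprime_quadratics {a b : ℤ} (h : IsCoprime a b) :
    IsCoprime (a ^ 2 + a * b + b ^ 2) (a ^ 2 - 3 * a * b + b ^ 2) := by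
  have h1 := isCoprime_quadratic_mul h 1
  rw [one_mul] at h1
  have h4 := (isCoprime_two_of_odd (odd_sq_add_mul_add_sq h)).pow_right (n := 2)
  have := (h4.mul_right h1).neg_right.add_mul_left_right 1
  rwa [show -(2 ^ 2 * (a * b)) + (a ^ 2 + a * b + b ^ 2) * 1 = a ^ 2 - 3 * a * b + b ^ 2 by
    ring] at this

theorem mul_eq_zero_of_quadratics_mul_eq_sq {a b c : ℤ} (h : IsCoprime a b)
    (hc : (a ^ 2 + a * b + b ^ 2) * (a ^ 2 - 3 * a * b + b ^ 2) = c ^ 2) : a * b = 0 := by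
  have hcop := isCoprime_quadratics h
  have hodd := odd_sq_add_mul_add_sq h
  have hX : 0 < a ^ 2 + a * b + b ^ 2 := by
    have : a ^ 2 + a * b + b ^ 2 ≠ 0 := by intro h; simp [h] at hodd
    have : 0 ≤ a ^ 2 + a * b + b ^ 2 := by nlinarith [sq_nonneg (a + b), sq_nonneg a, sq_nonneg b]
    omega
  have hY : 0 ≤ a ^ 2 - 3 * a * b + b ^ 2 := nonneg_of_mul_nonneg_right (hc ▸ sq_nonneg c) hX
  obtain ⟨r, hr⟩ := exists_sq_of_mul_eq_sq hcop hX.le hc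
  obtain ⟨s, hs⟩ := exists_sq_of_mul_eq_sq hcop.symm hY ((mul_comm _ _).trans hc)
  have hrodd : Odd r := by rw [hr] at hodd; simpa [Int.odd_pow] using hodd
  have hsodd : Odd s := by
    have : Odd (s ^ 2) := by
      rw [← hs, show a ^ 2 - 3 * a * b + b ^ 2 = a ^ 2 + a * b + b ^ 2 + 2 * (-2 * (a * b)) by ring]
      exact hodd.add_even (even_two_mul _)
    simpa [Int.odd_pow] using this
  obtain ⟨n, hn⟩ : Even (r - s) := hrodd.sub_odd hsodd
  obtain rfl : r = s + (n + n) := by linear_combination hn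
  have hab : a * b = (s + n) * n := by linarith
  refine mul_eq_zero_of_state _ (m := s + n) (n := n) rfl h ?_ hab (by linarith)
  apply isCoprime_of_add_sub
  rw [hr, hs] at hcop
  have := (IsCoprime.pow_left_iff two_pos).1 ((IsCoprime.pow_right_iff two_pos).1 hcop)
  convert this using 1 <;> ring

theorem isCoprime_add_sub {a b : ℤ} (h : IsCoprime a b) (hodd : Odd (a + b)) :
    IsCoprime (a + b) (a - b) := by
  have h1 : IsCoprime (a + b) a := by
    have := (h.add_mul_left_right 1).symm
    rwa [show b + a * 1 = a + b by ring] at this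
  have := ((isCoprime_two_of_odd hodd).mul_right h1).add_mul_left_right (-1)
  rwa [show 2 * a + (a + b) * -1 = a - b by ring] at this

theorem odd_of_sq {a : ℤ} (h : Odd (a ^ 2)) : Odd a := by
  simpa [Int.odd_pow] using h

theorem eq_of_dvd_seventeen {k : ℤ} (h : k ∣ 17) : k = 1 ∨ k = -1 ∨ k = 17 ∨ k = -17 := by
  obtain ⟨h1, h2⟩ := bounds_of_dvd (by norm_num) h
  obtain ⟨e, he⟩ := h
  interval_cases k <;> omega

/-- The system `4 f² + g² = k e²`, `f² - 4 g² = k h²` has no odd primitive solution. -/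
theorem false_of_odd_system {e f g h : ℤ} (he0 : e ≠ 0) (heh : IsCoprime e h) (hfg : IsCoprime f g)
    (he : Odd e) (hf : Odd f) (hg : Odd g)
    (H : e ^ 2 * (f ^ 2 - 4 * g ^ 2) = h ^ 2 * (4 * f ^ 2 + g ^ 2)) : False := by
  obtain ⟨k, h₁, h₂⟩ := exists_eq_mul_of_mul_eq (pow_ne_zero 2 he0) (heh.pow (n := 2)) H
  have hk : k ∣ 17 := dvd_of_dvd_mul_sq hfg ⟨h ^ 2 + 4 * e ^ 2, by linear_combination h₁ + 4 * h₂⟩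
    ⟨e ^ 2 - 4 * h ^ 2, by linear_combination h₂ - 4 * h₁⟩
  obtain ⟨e', he'⟩ := Int.exists_sq_eq_of_odd he
  obtain ⟨f', hf'⟩ := Int.exists_sq_eq_of_odd hf
  obtain ⟨g', hg'⟩ := Int.exists_sq_eq_of_odd hg
  rw [he', hf', hg'] at h₂
  rcases eq_of_dvd_seventeen hk with rfl | rfl | rfl | rfl <;> omega

theorem false_of_add_sq_eq_sq_of_add_sixteen_mul_sq {α β γ δ : ℤ} (hα : Even α)
    (hαγ : IsCoprime α γ) (h₁ : α ^ 2 + γ ^ 2 = β ^ 2) (h₂ : γ ^ 2 + 16 * β ^ 2 = δ ^ 2) :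
    False := by
  wlog hβ : 0 ≤ β generalizing β
  · exact this (β := -β) (by linear_combination h₁) (by linear_combination h₂) (by linarith)
  wlog hδ : 0 ≤ δ generalizing δ
  · exact this (δ := -δ) (by linear_combination h₂) (by linarith)
  have hγ : Odd γ := hαγ.odd_or_odd.resolve_left (Int.not_odd_iff_even.2 hα)
  have hβo : Odd β := odd_of_sq (h₁ ▸ (hα.pow_of_ne_zero two_ne_zero).add_odd hγ.pow)
  have hδo : Odd δ := odd_of_sq (h₂ ▸ hγ.pow.add_even (Even.mul_right (by decide) _))
  have hβγ : IsCoprime β γ := by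
    have := (hαγ.pow_left (m := 2)).add_mul_left_left γ
    rw [show α ^ 2 + γ * γ = β ^ 2 by linear_combination h₁] at this
    exact (IsCoprime.pow_left_iff two_pos).1 this
  have hβα : IsCoprime β α := by
    have := (hαγ.symm.pow_left (m := 2)).add_mul_left_left α
    rw [show γ ^ 2 + α * α = β ^ 2 by linear_combination h₁] at this
    exact (IsCoprime.pow_left_iff two_pos).1 this
  have hδβ : IsCoprime δ (4 * β) := by
    refine IsCoprime.mul_right ((isCoprime_two_of_odd hδo).pow_right (n := 2)) ?_
    have := (hβγ.symm.pow_left (m := 2)).add_mul_left_left (16 * β)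
    rw [show γ ^ 2 + β * (16 * β) = δ ^ 2 by linear_combination h₂] at this
    exact (IsCoprime.pow_left_iff two_pos).1 this
  have hcop₁ := isCoprime_add_sub hβα (hβo.add_even hα)
  obtain ⟨Q, P, hQ, hP, hPQ⟩ := exists_sq_sq_of_mul_eq_sq (n := γ) hcop₁ (by linarith)
    (by linear_combination -h₁)
  obtain ⟨k, l, hk, hl, hkl⟩ := exists_sq_sq_of_mul_eq_sq (n := γ)
    (isCoprime_add_sub hδβ (hδo.add_even (Even.mul_right (by decide) _))) (by linarith)
    (by linear_combination -h₂)
  have hγ0 : γ ≠ 0 := by rintro rfl; simp at hγ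
  obtain ⟨e, f, g, h, rfl, rfl, rfl, rfl⟩ := exists_four_factors (a := k) (b := l) (m := P) (n := Q)
    (by rintro rfl; simp at hkl; exact hγ0 hkl) (by linear_combination hPQ - hkl)
  rw [hQ, hP] at hcop₁
  have hc := (IsCoprime.pow_left_iff two_pos).1 ((IsCoprime.pow_right_iff two_pos).1 hcop₁)
  rw [hkl] at hγ hγ0
  obtain ⟨hef, hgh⟩ := Int.odd_mul.1 hγ
  obtain ⟨he, hf⟩ := Int.odd_mul.1 hef
  obtain ⟨hg, hh⟩ := Int.odd_mul.1 hgh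
  refine false_of_odd_system (left_ne_zero_of_mul (left_ne_zero_of_mul hγ0))
    hc.symm.of_mul_left_left.of_mul_right_right hc.of_mul_left_left.of_mul_right_right he hf hg ?_
  linear_combination 4 * hQ + 4 * hP - hk + hl

theorem eq_one_or_of_dvd_sixteen {k : ℤ} (h : k ∣ 16) (hk : Odd k) : k = 1 ∨ k = -1 := by
  obtain ⟨h1, h2⟩ := bounds_of_dvd (by norm_num) h
  obtain ⟨e, he⟩ := h
  obtain ⟨j, hj⟩ := hk
  interval_cases k <;> omega

theorem natAbs_lt_of_eq_mul {x y k : ℤ} (hy : y ≠ 0) (h : y = 2 * k * x) :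
    x.natAbs < y.natAbs := by
  subst h
  have hk : k ≠ 0 := by rintro rfl; simp at hy
  have hx : x ≠ 0 := by rintro rfl; simp at hy
  rw [Int.natAbs_mul]
  refine lt_mul_of_one_lt_left (Int.natAbs_pos.2 hx) ?_
  omega

theorem eq_zero_of_sq_sub_sq_of_sq_sub_seventeen_mul_sq (N : ℕ) : ∀ {α β γ δ : ℤ},
    α.natAbs = N → Even α → IsCoprime α β → β ^ 2 - α ^ 2 = δ ^ 2 → β ^ 2 - 17 * α ^ 2 = γ ^ 2 →
    α = 0 := by
  induction N using Nat.strong_induction_on with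
  | _ N ih =>
  intro α β γ δ hN hα hαβ h₁ h₂
  wlog hβ : 0 ≤ β generalizing β
  · exact this (β := -β) hαβ.neg_right (by linear_combination h₁) (by linear_combination h₂)
      (by linarith)
  by_contra hα0
  have hβo : Odd β := hαβ.odd_or_odd.resolve_left (Int.not_odd_iff_even.2 hα)
  have hα2 : Even (α ^ 2) := hα.pow_of_ne_zero two_ne_zero
  have hδo : Odd δ := odd_of_sq (h₁ ▸ hβo.pow.sub_even hα2)
  have hγo : Odd γ := odd_of_sq (h₂ ▸ hβo.pow.sub_even (hα2.mul_left _))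
  obtain ⟨a, ha⟩ := hα
  have hβδ : IsCoprime β δ := by
    have := (hαβ.pow_left (m := 2)).neg_left.add_mul_left_left β
    rw [show -α ^ 2 + β * β = δ ^ 2 by linear_combination h₁] at this
    exact ((IsCoprime.pow_left_iff two_pos).1 this).symm
  have hp : Prime (17 : ℤ) := by norm_num
  have hβ17 : ¬ (17 : ℤ) ∣ β := by
    intro hd
    have hγ17 : (17 : ℤ) ∣ γ := hp.dvd_of_dvd_pow (n := 2)
      (h₂ ▸ dvd_sub (dvd_pow hd two_ne_zero) (dvd_mul_right _ _))
    obtain ⟨u, rfl⟩ := hd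
    obtain ⟨v, rfl⟩ := hγ17
    have : (17 : ℤ) ∣ α := hp.dvd_of_dvd_pow (n := 2) ⟨u ^ 2 - v ^ 2, by linarith⟩
    exact hp.not_isUnit (hαβ.isUnit_of_dvd' this (dvd_mul_right _ _))
  have hβγ : IsCoprime β γ := by
    have := (((hp.coprime_iff_not_dvd.2 hβ17).mul_left
      (hαβ.pow_left (m := 2)))).neg_left.add_mul_left_left β
    rw [show -(17 * α ^ 2) + β * β = γ ^ 2 by linear_combination h₂] at this
    exact ((IsCoprime.pow_left_iff two_pos).1 this).symm
  obtain ⟨m, n, hmn, -, hamn, hcmn⟩ := exists_param_of_sq_sub_sq (n := a) hβδ hβo hδo hβ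
    (by linear_combination h₁ + (α + 2 * a) * ha)
  obtain ⟨l, k, hlk, -, halk, hclk⟩ := exists_param_of_sq_sub_sq_prime (n := a) hp (by norm_num)
    hβγ hβo hγo hβ (by linear_combination h₂ + 17 * (α + 2 * a) * ha)
  have ha0 : a ≠ 0 := by rintro rfl; exact hα0 ha
  obtain ⟨e, f, g, h, rfl, rfl, rfl, rfl⟩ := exists_four_factors (a := m) (b := n) (m := k) (n := l)
    (by rintro rfl; simp at hamn; exact ha0 hamn) (by linear_combination halk - hamn)
  have heh : IsCoprime e h := hcmn.of_mul_left_left.of_mul_right_right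
  have hfg : IsCoprime f g := hcmn.of_mul_left_right.of_mul_right_left
  have hgh : IsCoprime g h := hclk.symm.of_mul_left_right.of_mul_right_right
  have hef : IsCoprime e f := hclk.symm.of_mul_left_left.of_mul_right_left
  have he0 : e ≠ 0 := by rintro rfl; simp at hamn; exact ha0 hamn
  obtain ⟨k, h₃, h₄⟩ := exists_eq_mul_of_mul_eq (pow_ne_zero 2 he0) (heh.pow (n := 2))
    (show e ^ 2 * (f ^ 2 - g ^ 2) = h ^ 2 * (17 * f ^ 2 - g ^ 2) by linear_combination hlk - hmn)
  have hk : k ∣ 16 := dvd_of_dvd_mul_sq hfg ⟨e ^ 2 - h ^ 2, by linear_combination h₄ - h₃⟩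
    ⟨e ^ 2 - 17 * h ^ 2, by linear_combination h₄ - 17 * h₃⟩
  have hαe : α = 2 * (e * f * g * h) := by rw [ha, hamn]; ring
  have hlt_f : f.natAbs < N := hN ▸ natAbs_lt_of_eq_mul (k := e * g * h) hα0 (by rw [hαe]; ring)
  have hlt_h : h.natAbs < N := hN ▸ natAbs_lt_of_eq_mul (k := e * f * g) hα0 (by rw [hαe]; ring)
  have hf0 : f ≠ 0 := by rintro rfl; simp [hαe] at hα0
  have hh0 : h ≠ 0 := by rintro rfl; simp [hαe] at hα0
  rw [hmn] at hβo
  have hpar : ¬ (Odd (e * f) ∧ Odd (g * h)) := fun hc =>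
    Int.not_odd_iff_even.2 (hc.1.pow.add_odd hc.2.pow) hβo
  rcases Int.even_or_odd f with hf | hf
  · have hg : Odd g := hfg.odd_or_odd.resolve_left (Int.not_odd_iff_even.2 hf)
    have he : Odd e := hef.odd_or_odd.resolve_right (Int.not_odd_iff_even.2 hf)
    have hko : Odd k := by
      have : Odd (k * e ^ 2) := h₄ ▸
        ((hf.pow_of_ne_zero two_ne_zero).mul_left 17).sub_odd hg.pow
      exact (Int.odd_mul.1 this).1
    rcases eq_one_or_of_dvd_sixteen hk hko with rfl | rfl
    · obtain ⟨f', hf'⟩ := hf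
      obtain ⟨e', he'⟩ := Int.exists_sq_eq_of_odd he
      obtain ⟨g', hg'⟩ := Int.exists_sq_eq_of_odd hg
      rw [hf', he', hg'] at h₄
      ring_nf at h₄
      omega
    · exact hf0 (ih _ hlt_f rfl hf hfg (δ := h) (γ := e) (by linear_combination -h₃)
        (by linear_combination -h₄))
  · rcases Int.even_or_odd g with hg | hg
    · have hh : Odd h := hgh.odd_or_odd.resolve_left (Int.not_odd_iff_even.2 hg)
      have hko : Odd k := by
        have : Odd (k * h ^ 2) := h₃ ▸ hf.pow.sub_even (hg.pow_of_ne_zero two_ne_zero)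
        exact (Int.odd_mul.1 this).1
      rcases eq_one_or_of_dvd_sixteen hk hko with rfl | rfl
      · exact false_of_add_sq_eq_sq_of_add_sixteen_mul_sq hg hgh (β := f) (δ := e)
          (by linear_combination -h₃) (by linear_combination h₄ - h₃)
      · obtain ⟨g', hg'⟩ := hg
        obtain ⟨h', hh'⟩ := Int.exists_sq_eq_of_odd hh
        obtain ⟨f', hf'⟩ := Int.exists_sq_eq_of_odd hf
        rw [hf', hh', hg'] at h₃
        ring_nf at h₃
        omega
    · have hodd : Odd (e ^ 2 - h ^ 2) := by
        rcases Int.even_or_odd e with he | he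
        · exact (he.pow_of_ne_zero two_ne_zero).sub_odd
            (heh.odd_or_odd.resolve_left (Int.not_odd_iff_even.2 he)).pow
        · refine he.pow.sub_even (Even.pow_of_ne_zero ?_ two_ne_zero)
          by_contra hh
          exact hpar ⟨he.mul hf, hg.mul (Int.not_even_iff_odd.1 hh)⟩
      have h16 : (16 : ℤ) ∣ k := by
        have hcop := ((isCoprime_two_of_odd hodd).pow_right (n := 4)).symm
        norm_num at hcop
        exact hcop.dvd_of_dvd_mul_right ⟨f ^ 2, by linear_combination h₃ - h₄⟩
      have hk16 : k = 16 ∨ k = -16 := by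
        obtain ⟨h1, h2⟩ := bounds_of_dvd (by norm_num) hk
        obtain ⟨j, hj⟩ := h16
        obtain ⟨i, hi⟩ := hk
        have : k ≠ 0 := by rintro rfl; simp at hi
        omega
      obtain ⟨f', hf'⟩ := Int.exists_sq_eq_of_odd hf
      rcases hk16 with rfl | rfl
      · have hh : Even h := by
          by_contra hh
          obtain ⟨h', hh'⟩ := Int.exists_sq_eq_of_odd (Int.not_even_iff_odd.1 hh)
          have he : Even e := by
            by_contra he
            exact hpar ⟨(Int.not_even_iff_odd.1 he).mul hf, hg.mul (Int.not_even_iff_odd.1 hh)⟩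
          obtain ⟨e', rfl⟩ := he
          ring_nf at h₃ h₄ hh' hf'
          omega
        exact hh0 (ih _ hlt_h rfl hh heh.symm (δ := f) (γ := g) (by linarith) (by linarith))
      · have he : Even e := by
          by_contra he
          obtain ⟨e', he'⟩ := Int.exists_sq_eq_of_odd (Int.not_even_iff_odd.1 he)
          have hh : Even h := by
            by_contra hh
            exact hpar ⟨(Int.not_even_iff_odd.1 he).mul hf, hg.mul (Int.not_even_iff_odd.1 hh)⟩
          obtain ⟨h', rfl⟩ := hh
          ring_nf at h₃ h₄ he' hf'
          omega
        exact false_of_add_sq_eq_sq_of_add_sixteen_mul_sq he hef (β := h) (δ := g)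
          (by linarith) (by linarith)

theorem false_of_seventeen_system {x y z w : ℤ} (hxy : IsCoprime x y) (hxz : IsCoprime x z)
    (hxw : IsCoprime x w) (hyz : IsCoprime y z) (hyw : IsCoprime y w) (hzw : IsCoprime z w)
    (hx0 : x ≠ 0) (hw0 : w ≠ 0)
    (h₁ : x ^ 2 + w ^ 2 = y * z) (h₂ : y ^ 2 - z ^ 2 = x * w) : False := by
  by_cases hodd : Odd y ∧ Odd z
  · obtain ⟨p, hp⟩ : Even (y - z) := hodd.1.sub_odd hodd.2
    obtain ⟨q, rfl⟩ : ∃ q, z = q - p := ⟨z + p, by ring⟩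
    obtain rfl : y = q + p := by linear_combination hp
    clear hp
    have hxw4 : x * w = 4 * p * q := by linear_combination -h₂
    wlog hx : Even x generalizing x w
    · refine this hxw.symm hw0 hx0 hzw.symm hxz.symm hyw.symm hxy.symm (by linear_combination h₁)
        (by linear_combination h₂) (by linear_combination hxw4) ?_
      have : Even (x * w) := ⟨2 * p * q, by rw [hxw4]; ring⟩
      exact (Int.even_mul.1 this).resolve_left hx
    have hw : Odd w := hxw.odd_or_odd.resolve_left (Int.not_odd_iff_even.2 hx)
    have hpq : IsCoprime p q := by
      obtain ⟨u, v, h⟩ := hyz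
      exact ⟨u - v, u + v, by linear_combination h⟩
    have hp : Even p := by
      by_contra hp
      rw [Int.not_even_iff_odd] at hp
      have hq : Even q := by
        by_contra hq
        exact Int.not_even_iff_odd.2 hodd.1 ((Int.not_even_iff_odd.1 hq).add_odd hp)
      obtain ⟨x', rfl⟩ := hx
      obtain ⟨w', hw'⟩ := Int.exists_sq_eq_of_odd hw
      obtain ⟨p', hp'⟩ := Int.exists_sq_eq_of_odd hp
      obtain ⟨q', rfl⟩ := hq
      ring_nf at h₁ hw' hp'
      omega
    have hq : Odd q := hpq.odd_or_odd.resolve_left (Int.not_odd_iff_even.2 hp)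
    obtain ⟨x', rfl⟩ : (4 : ℤ) ∣ x := by
      have hcop := ((isCoprime_two_of_odd hw).pow_right (n := 2)).symm
      norm_num at hcop
      exact hcop.dvd_of_dvd_mul_right ⟨p * q, by rw [hxw4]; ring⟩
    obtain ⟨α, β, γ, δ, rfl, rfl, rfl, rfl⟩ := exists_four_factors (a := x') (b := w) (m := p)
      (n := q) (by rintro rfl; simp at hx0) (by linarith)
    obtain ⟨hγ, hδ⟩ := Int.odd_mul.1 hw
    obtain ⟨hβ, -⟩ := Int.odd_mul.1 hq
    have hα : Even α := (Int.even_mul.1 hp).resolve_right (Int.not_even_iff_odd.2 hγ)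
    have hα0 : α ≠ 0 := by rintro rfl; simp at hx0
    have hαδ : IsCoprime α δ := hpq.of_mul_left_left.of_mul_right_right
    have hαβ : IsCoprime α β := hpq.of_mul_left_left.of_mul_right_left
    have hγβ : IsCoprime γ β := hpq.of_mul_left_right.of_mul_right_left
    have hαγ : IsCoprime α γ := hxw.of_mul_left_right.of_mul_left_left.of_mul_right_left
    obtain ⟨k, h₃, h₄⟩ := exists_eq_mul_of_mul_eq (pow_ne_zero 2 hα0) (hαδ.pow (n := 2))
      (show α ^ 2 * (16 * β ^ 2 + γ ^ 2) = δ ^ 2 * (β ^ 2 - γ ^ 2) by linear_combination h₁)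
    have hk : k ∣ 17 := dvd_of_dvd_mul_sq hγβ
      ⟨δ ^ 2 - 16 * α ^ 2, by linear_combination h₃ - 16 * h₄⟩
      ⟨δ ^ 2 + α ^ 2, by linear_combination h₃ + h₄⟩
    obtain ⟨b, hb⟩ := Int.exists_sq_eq_of_odd hβ
    obtain ⟨c, hc⟩ := Int.exists_sq_eq_of_odd hγ
    obtain ⟨d, hd⟩ := Int.exists_sq_eq_of_odd hδ
    rcases eq_of_dvd_seventeen hk with rfl | rfl | rfl | rfl
    · exact false_of_add_sq_eq_sq_of_add_sixteen_mul_sq hα hαγ (β := β) (δ := δ) (by linarith)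
        (by linarith)
    · omega
    · exact hα0 (eq_zero_of_sq_sub_sq_of_sq_sub_seventeen_mul_sq _ rfl hα hαβ (δ := δ) (γ := γ)
        (by linarith) (by linarith))
    · omega
  · have hx : Odd x := by
      have := hxy.odd_or_odd; have := hxz.odd_or_odd; tauto
    have hw : Odd w := by
      have := hyw.odd_or_odd; have := hzw.odd_or_odd; tauto
    obtain ⟨β, α, δ, γ, rfl, rfl, h₃, h₄⟩ := exists_four_factors (a := x) (b := w)
      (m := y + z) (n := y - z) hx0 (by linear_combination -h₂)
    obtain ⟨hβ, hα⟩ := Int.odd_mul.1 hx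
    obtain ⟨hδ, hγ⟩ := Int.odd_mul.1 hw
    refine false_of_odd_system (e := δ) (f := β) (g := γ) (h := α) (left_ne_zero_of_mul hw0)
      hxw.symm.of_mul_left_left.of_mul_right_right
      hxw.of_mul_left_left.of_mul_right_right hδ hβ hγ ?_
    linear_combination -4 * h₁ + (y - z + α * γ) * h₄ - (y + z + β * δ) * h₃

theorem mul_eq_zero_of_quartic_eq_sq {a b c : ℤ} (h : IsCoprime a b)
    (hc : a ^ 4 - 2 * a ^ 3 * b + 3 * a ^ 2 * b ^ 2 + 2 * a * b ^ 3 + b ^ 4 = c ^ 2) :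
    a * b = 0 := by
  wlog hc0 : 0 ≤ c generalizing c
  · exact this (c := -c) (by linear_combination hc) (by linarith)
  have hG : Odd (a ^ 2 - a * b - b ^ 2) := by
    rw [show a ^ 2 - a * b - b ^ 2 = a ^ 2 + a * b + b ^ 2 - 2 * (a * b + b ^ 2) by ring]
    exact (odd_sq_add_mul_add_sq h).sub_even (even_two_mul _)
  have hcG : c ^ 2 - (a ^ 2 - a * b - b ^ 2) ^ 2 = 4 * (a * b) ^ 2 := by linear_combination -hc
  have hco : Odd c := odd_of_sq (by
    rw [show c ^ 2 = (a ^ 2 - a * b - b ^ 2) ^ 2 + 2 * (2 * (a * b) ^ 2) by linear_combination hcG]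
    exact hG.pow.add_even (even_two_mul _))
  have hGab : IsCoprime (a ^ 2 - a * b - b ^ 2) (a * b) := by
    refine IsCoprime.mul_right ?_ ?_
    · have := ((h.pow_right (n := 2)).neg_right.add_mul_left_right (a - b)).symm
      rwa [show -b ^ 2 + a * (a - b) = a ^ 2 - a * b - b ^ 2 by ring] at this
    · have := ((h.symm.pow_right (n := 2)).add_mul_left_right (-b - a)).symm
      rwa [show a ^ 2 + b * (-b - a) = a ^ 2 - a * b - b ^ 2 by ring] at this
  have hcop : IsCoprime c (a ^ 2 - a * b - b ^ 2) := by
    have := ((((isCoprime_two_of_odd hG).mul_right hGab).pow_right (n := 2)).add_mul_left_right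
      (a ^ 2 - a * b - b ^ 2)).symm
    rw [show (2 * (a * b)) ^ 2 + (a ^ 2 - a * b - b ^ 2) * (a ^ 2 - a * b - b ^ 2) = c ^ 2 by
      linear_combination hc] at this
    exact (IsCoprime.pow_left_iff two_pos).1 this
  obtain ⟨P, Q, -, hPQ, habPQ, hPQc⟩ := exists_param_of_sq_sub_sq hcop hco hG hc0 hcG
  by_contra h0
  obtain ⟨x, y, z, w, rfl, rfl, rfl, rfl⟩ := exists_four_factors (left_ne_zero_of_mul h0) habPQ
  have hyz : IsCoprime y z := h.of_mul_left_right.of_mul_right_left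
  have hxw : IsCoprime x w := h.of_mul_left_left.of_mul_right_right
  have hyw : IsCoprime y w := h.of_mul_left_right.of_mul_right_right
  have hxz : IsCoprime x z := h.of_mul_left_left.of_mul_right_left
  have hxy : IsCoprime x y := hPQc.of_mul_left_left.of_mul_right_left
  have hzw : IsCoprime z w := hPQc.of_mul_left_right.of_mul_right_right
  have key : (x ^ 2 + w ^ 2) * (y ^ 2 - z ^ 2) = x * w * (y * z) := by linear_combination hPQ
  have cop₁ : IsCoprime (y * z) (y ^ 2 - z ^ 2) := isCoprime_mul_sq_sub_sq hyz
  have cop₂ : IsCoprime (x * w) (x ^ 2 + w ^ 2) := by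
    have := (isCoprime_quadratic_mul hxw 0).symm
    rwa [show x ^ 2 + 0 * x * w + w ^ 2 = x ^ 2 + w ^ 2 by ring] at this
  have hyz0 : y * z ≠ 0 := by
    intro h; apply h0; linear_combination x * w * h
  obtain ⟨k, hk, hk'⟩ := exists_eq_mul_of_mul_eq hyz0 cop₁
    (show y * z * (x * w) = (y ^ 2 - z ^ 2) * (x ^ 2 + w ^ 2) by linear_combination -key)
  have hx0 : x ≠ 0 := by rintro rfl; simp at h0
  have hw0 : w ≠ 0 := by rintro rfl; simp at h0
  rcases Int.isUnit_iff.1 (cop₂.isUnit_of_dvd' ⟨_, hk⟩ ⟨_, hk'⟩) with rfl | rfl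
  · exact false_of_seventeen_system hxy hxz hxw hyz hyw hzw hx0 hw0 (by linear_combination hk')
      (by linear_combination -hk)
  · exact false_of_seventeen_system hxy.neg_neg hxz.neg_left hxw.neg_left hyz.neg_left hyw.neg_left
      hzw (neg_ne_zero.2 hx0) hw0 (by linear_combination hk') (by linear_combination hk)

theorem false_of_three_dvd {f g x y : ℤ} (hfg : IsCoprime f g)
    (h₁ : (3 : ℤ) ∣ f ^ 2 + g ^ 2 + x ^ 2) (h₂ : (3 : ℤ) ∣ f ^ 2 + g ^ 2 - y ^ 2) : False := by
  have sq : ∀ a : ℤ, (a ^ 2 % 3 = 1) ∨ (a ^ 2 % 3 = 0 ∧ 3 ∣ a) := by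
    intro a
    have h : a % 3 = 0 ∨ a % 3 = 1 ∨ a % 3 = 2 := by omega
    rcases h with h | h | h <;> simp [pow_two, Int.mul_emod, h, Int.dvd_iff_emod_eq_zero]
  have hnot : ¬ ((3 : ℤ) ∣ f ∧ (3 : ℤ) ∣ g) := fun h =>
    Int.prime_three.not_isUnit (hfg.isUnit_of_dvd' h.1 h.2)
  rcases sq f with hf | hf <;> rcases sq g with hg | hg <;> rcases sq x with hx | hx <;>
    rcases sq y with hy | hy <;> omega

theorem exists_dvd_fifteen_of_mul_eq {e f g h A B : ℤ} (hfg : IsCoprime f g)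
    (heh : IsCoprime (5 * e ^ 2) (h ^ 2)) (he : e ≠ 0) (hAB : 5 * e ^ 2 * A = h ^ 2 * B)
    {i j i' j' : ℤ} (h₁ : 15 * f ^ 2 = i * A + j * B) (h₂ : 15 * g ^ 2 = i' * A + j' * B) :
    ∃ k, A = k * h ^ 2 ∧ B = k * (5 * e ^ 2) ∧ -15 ≤ k ∧ k ≤ 15 ∧ ∃ d, 15 = k * d := by
  obtain ⟨k, hk, hk'⟩ := exists_eq_mul_of_mul_eq (by positivity) heh hAB
  have hd : k ∣ 15 := dvd_of_dvd_mul_sq hfg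
    ⟨i * h ^ 2 + j * (5 * e ^ 2), by rw [h₁, hk, hk']; ring⟩
    ⟨i' * h ^ 2 + j' * (5 * e ^ 2), by rw [h₂, hk, hk']; ring⟩
  obtain ⟨hl, hu⟩ := bounds_of_dvd (by norm_num) hd
  exact ⟨k, hk, hk', hl, hu, hd⟩

theorem four_dvd_of_mul_eq {P Q c : ℤ} (hQ : Odd Q) (h : P * Q = 4 * c) : (4 : ℤ) ∣ P := by
  have hcop := ((isCoprime_two_of_odd hQ).pow_right (n := 2)).symm
  norm_num at hcop
  exact hcop.dvd_of_dvd_mul_right ⟨c, h⟩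

theorem even_of_odd_prime_mul_sq_add {l P Q : ℤ} (h : Odd (l * P ^ 2 + Q ^ 2)) (hl : Odd l) :
    (Even P ∧ Odd Q) ∨ (Odd P ∧ Even Q) := by
  rcases Int.even_or_odd P with hP | hP <;> rcases Int.even_or_odd Q with hQ | hQ
  · exact absurd h (Int.not_odd_iff_even.2 (((hP.pow_of_ne_zero two_ne_zero).mul_left l).add
      (hQ.pow_of_ne_zero two_ne_zero)))
  · exact Or.inl ⟨hP, hQ⟩
  · exact Or.inr ⟨hP, hQ⟩
  · exact absurd h (Int.not_odd_iff_even.2 ((hl.mul hP.pow).add_odd hQ.pow))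

theorem Int.exists_sq_eq_of_even {r : ℤ} (hr : Even r) : ∃ j, r ^ 2 = 4 * j := by
  obtain ⟨k, rfl⟩ := hr
  exact ⟨k ^ 2, by ring⟩

theorem eq_zero_of_sq_sub_five_mul_sq (N : ℕ) : ∀ {U V s r : ℤ},
    U.natAbs = N → Even U → IsCoprime U V → V ^ 2 - 5 * U ^ 2 = s ^ 2 →
    V ^ 2 + 75 * U ^ 2 = r ^ 2 → U = 0 := by
  induction N using Nat.strong_induction_on with
  | _ N ih =>
  intro U V s r hN hU hUV h₁ h₂
  wlog hV : 0 ≤ V generalizing V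
  · exact this (V := -V) hUV.neg_right (by linear_combination h₁) (by linear_combination h₂)
      (by linarith)
  wlog hr : 0 ≤ r generalizing r
  · exact this (r := -r) (by linear_combination h₂) (by linarith)
  by_contra hU0
  have hVo : Odd V := hUV.odd_or_odd.resolve_left (Int.not_odd_iff_even.2 hU)
  have hU2 : Even (U ^ 2) := hU.pow_of_ne_zero two_ne_zero
  have hso : Odd s := odd_of_sq (h₁ ▸ hVo.pow.sub_even (hU2.mul_left _))
  have hro : Odd r := odd_of_sq (h₂ ▸ hVo.pow.add_even (hU2.mul_left _))
  obtain ⟨u, hu⟩ := hU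
  have hp : Prime (5 : ℤ) := by norm_num
  have hV5 : ¬ (5 : ℤ) ∣ V := by
    intro hd
    have hs5 : (5 : ℤ) ∣ s := hp.dvd_of_dvd_pow (n := 2)
      (h₁ ▸ dvd_sub (dvd_pow hd two_ne_zero) (dvd_mul_right _ _))
    obtain ⟨v, rfl⟩ := hd
    obtain ⟨t, rfl⟩ := hs5
    have : (5 : ℤ) ∣ U := hp.dvd_of_dvd_pow (n := 2) ⟨v ^ 2 - t ^ 2, by linarith⟩
    exact hp.not_isUnit (hUV.isUnit_of_dvd' this (dvd_mul_right _ _))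
  have h5U : IsCoprime (5 * U ^ 2) V :=
    (hp.coprime_iff_not_dvd.2 hV5).mul_left (hUV.pow_left (m := 2))
  have hVs : IsCoprime V s := by
    have := h5U.neg_left.add_mul_left_left V
    rw [show -(5 * U ^ 2) + V * V = s ^ 2 by linear_combination h₁] at this
    exact ((IsCoprime.pow_left_iff two_pos).1 this).symm
  have hUs : IsCoprime U s := by
    have := (hUV.symm.pow_left (m := 2)).add_mul_left_left (-5 * U)
    rw [show V ^ 2 + U * (-5 * U) = s ^ 2 by linear_combination h₁] at this
    exact ((IsCoprime.pow_left_iff two_pos).1 this).symm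
  have h5s : IsCoprime 5 s := by
    have := (((hp.coprime_iff_not_dvd.2 hV5).symm.pow_left (m := 2))).add_mul_left_left (-U ^ 2)
    rw [show V ^ 2 + 5 * -U ^ 2 = s ^ 2 by linear_combination h₁] at this
    exact ((IsCoprime.pow_left_iff two_pos).1 this).symm
  have hrs : IsCoprime r s := by
    have := ((((isCoprime_two_of_odd hso).symm.pow_left (m := 4)).mul_left h5s).mul_left
      (hUs.pow_left (m := 2))).add_mul_left_left s
    rw [show 2 ^ 4 * 5 * U ^ 2 + s * s = r ^ 2 by linear_combination h₂ - h₁] at this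
    exact (IsCoprime.pow_left_iff two_pos).1 this
  obtain ⟨α, β, hV', hs, huαβ, hαβ⟩ : ∃ α β, V = 5 * α ^ 2 + β ^ 2 ∧
      (s = 5 * α ^ 2 - β ^ 2 ∨ s = β ^ 2 - 5 * α ^ 2) ∧ u = α * β ∧ IsCoprime α β :=
    exists_param_of_sq_sub_sq_prime hp (by norm_num) hVs hVo hso hV
      (by linear_combination h₁ + 5 * (U + 2 * u) * hu)
  obtain ⟨P, Q, hr', hs', huPQ, hPQ⟩ : ∃ P Q, r = 5 * P ^ 2 + Q ^ 2 ∧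
      (s = 5 * P ^ 2 - Q ^ 2 ∨ s = Q ^ 2 - 5 * P ^ 2) ∧ 4 * u = P * Q ∧ IsCoprime P Q :=
    exists_param_of_sq_sub_sq_prime hp (by norm_num) hrs hro hso hr
      (by linear_combination h₁ - h₂ + 80 * (U + 2 * u) * hu)
  have hu0 : u ≠ 0 := by rintro rfl; exact hU0 hu
  have hα0 : α ≠ 0 := by rintro rfl; simp at huαβ; exact hu0 huαβ
  have hP0 : P ≠ 0 := by rintro rfl; simp at huPQ; exact hu0 huPQ
  have hmul : P * Q = 4 * (α * β) := by rw [← huPQ, huαβ]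
  have hsign : 5 * α ^ 2 - β ^ 2 = 5 * P ^ 2 - Q ^ 2 ∨ 5 * α ^ 2 - β ^ 2 = Q ^ 2 - 5 * P ^ 2 := by
    rcases hs with hs | hs <;> rcases hs' with hs' | hs'
    · exact Or.inl (by linarith)
    · exact Or.inr (by linarith)
    · exact Or.inr (by linarith)
    · exact Or.inl (by linarith)
  have hβ5 : IsCoprime 5 β := by
    refine hp.coprime_iff_not_dvd.2 fun hd => hV5 ?_
    rw [hV']
    exact dvd_add (dvd_mul_right _ _) (dvd_pow hd two_ne_zero)
  have h5 : Odd (5 : ℤ) := by decide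
  rw [hV'] at hVo
  rw [hr'] at hro
  have hUu : U = 2 * (α * β) := by rw [hu, huαβ]; ring
  rcases even_of_odd_prime_mul_sq_add hVo h5 with ⟨hα, hβ⟩ | ⟨hα, hβ⟩ <;>
    rcases even_of_odd_prime_mul_sq_add hro h5 with ⟨hP, hQ⟩ | ⟨hP, hQ⟩
  · obtain ⟨P', rfl⟩ := four_dvd_of_mul_eq hQ hmul
    obtain ⟨e, f, g, h, rfl, rfl, rfl, rfl⟩ := exists_four_factors (a := P') (b := Q) (m := α)
      (n := β) (by rintro rfl; simp at hP0) (by linarith)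
    have he0 : e ≠ 0 := left_ne_zero_of_mul hα0
    obtain ⟨hg, hh⟩ := Int.odd_mul.1 hQ
    obtain ⟨hf, -⟩ := Int.odd_mul.1 hβ
    have he : Even e := (Int.even_mul.1 hα).resolve_right (Int.not_even_iff_odd.2 hg)
    obtain ⟨f', hf'⟩ := Int.exists_sq_eq_of_odd hf
    obtain ⟨g', hg'⟩ := Int.exists_sq_eq_of_odd hg
    obtain ⟨h', hh'⟩ := Int.exists_sq_eq_of_odd hh
    have hsign : 5 * (e * g) ^ 2 - (f * h) ^ 2 = 5 * (4 * (e * f)) ^ 2 - (g * h) ^ 2 := by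
      refine hsign.resolve_right fun hc => ?_
      obtain ⟨a, ha⟩ := Int.exists_sq_eq_of_even hα
      obtain ⟨b, hb⟩ := Int.exists_sq_eq_of_odd hβ
      obtain ⟨p, hp⟩ := Int.exists_sq_eq_of_even hP
      obtain ⟨q, hq⟩ := Int.exists_sq_eq_of_odd hQ
      omega
    have hfg : IsCoprime f g := hαβ.symm.of_mul_left_left.of_mul_right_right
    have heh : IsCoprime e h := hαβ.of_mul_left_left.of_mul_right_right
    have hef : IsCoprime e f := hαβ.of_mul_left_left.of_mul_right_left
    obtain ⟨k, h₃, h₄, hl, hu', d, hd⟩ := exists_dvd_fifteen_of_mul_eq hfg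
      ((hβ5.of_mul_right_right.pow_right).mul_left heh.pow) he0
      (show 5 * e ^ 2 * (g ^ 2 - 16 * f ^ 2) = h ^ 2 * (f ^ 2 - g ^ 2) by
        linear_combination hsign)
      (show 15 * f ^ 2 = -1 * (g ^ 2 - 16 * f ^ 2) + -1 * (f ^ 2 - g ^ 2) by ring)
      (show 15 * g ^ 2 = -1 * (g ^ 2 - 16 * f ^ 2) + -16 * (f ^ 2 - g ^ 2) by ring)
    have hk : k = 1 ∨ k = -15 := by
      rw [hf', hg', hh'] at h₃
      interval_cases k <;> omega
    have hf2 := sq_pos_of_ne_zero (show f ≠ 0 by rintro rfl; simp at hf)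
    have he2 := sq_nonneg e
    have hh2 := sq_nonneg h
    rcases hk with rfl | rfl
    · linarith
    · have hlt : e.natAbs < N := hN ▸ natAbs_lt_of_eq_mul (k := f * g * h) hU0 (by rw [hUu]; ring)
      exact he0 (ih _ hlt rfl he hef (s := h) (r := g) (by linarith) (by linarith))
  · obtain ⟨Q', rfl⟩ := four_dvd_of_mul_eq hP ((mul_comm _ _).trans hmul)
    obtain ⟨e, f, g, h, rfl, rfl, rfl, rfl⟩ := exists_four_factors (a := P) (b := Q') (m := α)
      (n := β) hP0 (by linarith)
    have he0 : e ≠ 0 := left_ne_zero_of_mul hα0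
    obtain ⟨he, hf⟩ := Int.odd_mul.1 hP
    obtain ⟨-, hh⟩ := Int.odd_mul.1 hβ
    obtain ⟨e', he'⟩ := Int.exists_sq_eq_of_odd he
    obtain ⟨f', hf'⟩ := Int.exists_sq_eq_of_odd hf
    have hg : Even g := (Int.even_mul.1 hα).resolve_left (Int.not_even_iff_odd.2 he)
    obtain ⟨g', hg'⟩ := Int.exists_sq_eq_of_even hg
    have hsign : 5 * (e * g) ^ 2 - (f * h) ^ 2 = (4 * (g * h)) ^ 2 - 5 * (e * f) ^ 2 := by
      refine hsign.resolve_left fun hc => ?_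
      obtain ⟨a, ha⟩ := Int.exists_sq_eq_of_even hα
      obtain ⟨b, hb⟩ := Int.exists_sq_eq_of_odd hβ
      obtain ⟨p, hp⟩ := Int.exists_sq_eq_of_odd hP
      obtain ⟨q, hq⟩ := Int.exists_sq_eq_of_even hQ
      omega
    have hfg : IsCoprime f g := hαβ.symm.of_mul_left_left.of_mul_right_right
    have heh : IsCoprime e h := hαβ.of_mul_left_left.of_mul_right_right
    obtain ⟨k, h₃, h₄, hl, hu', d, hd⟩ := exists_dvd_fifteen_of_mul_eq hfg
      ((hβ5.of_mul_right_right.pow_right).mul_left heh.pow) he0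
      (show 5 * e ^ 2 * (f ^ 2 + g ^ 2) = h ^ 2 * (f ^ 2 + 16 * g ^ 2) by
        linear_combination hsign)
      (show 15 * f ^ 2 = 16 * (f ^ 2 + g ^ 2) + -1 * (f ^ 2 + 16 * g ^ 2) by ring)
      (show 15 * g ^ 2 = -1 * (f ^ 2 + g ^ 2) + 1 * (f ^ 2 + 16 * g ^ 2) by ring)
    have hf2 := sq_nonneg f
    have hg2 := sq_nonneg g
    have he2 := sq_nonneg e
    obtain rfl : k = 5 := by
      rw [hf', he', hg'] at h₄
      interval_cases k <;> omega
    exact false_of_three_dvd hfg (x := h) (y := e) ⟨2 * h ^ 2, by linarith⟩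
      ⟨8 * e ^ 2 - 5 * g ^ 2, by linarith⟩
  · obtain ⟨P', rfl⟩ := four_dvd_of_mul_eq hQ hmul
    obtain ⟨e, f, g, h, rfl, rfl, rfl, rfl⟩ := exists_four_factors (a := P') (b := Q) (m := α)
      (n := β) (by rintro rfl; simp at hP0) (by linarith)
    have he0 : e ≠ 0 := left_ne_zero_of_mul hα0
    obtain ⟨hg, hh⟩ := Int.odd_mul.1 hQ
    obtain ⟨he, -⟩ := Int.odd_mul.1 hα
    obtain ⟨g', hg'⟩ := Int.exists_sq_eq_of_odd hg
    obtain ⟨h', hh'⟩ := Int.exists_sq_eq_of_odd hh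
    have hf : Even f := (Int.even_mul.1 hβ).resolve_right (Int.not_even_iff_odd.2 hh)
    obtain ⟨f', hf'⟩ := Int.exists_sq_eq_of_even hf
    have hsign : 5 * (e * g) ^ 2 - (f * h) ^ 2 = (g * h) ^ 2 - 5 * (4 * (e * f)) ^ 2 := by
      refine hsign.resolve_left fun hc => ?_
      obtain ⟨a, ha⟩ := Int.exists_sq_eq_of_odd hα
      obtain ⟨b, hb⟩ := Int.exists_sq_eq_of_even hβ
      obtain ⟨p, hp⟩ := Int.exists_sq_eq_of_even hP
      obtain ⟨q, hq⟩ := Int.exists_sq_eq_of_odd hQ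
      omega
    have hfg : IsCoprime f g := hαβ.symm.of_mul_left_left.of_mul_right_right
    have heh : IsCoprime e h := hαβ.of_mul_left_left.of_mul_right_right
    obtain ⟨k, h₃, h₄, hl, hu', d, hd⟩ := exists_dvd_fifteen_of_mul_eq hfg
      ((hβ5.of_mul_right_right.pow_right).mul_left heh.pow) he0
      (show 5 * e ^ 2 * (g ^ 2 + 16 * f ^ 2) = h ^ 2 * (f ^ 2 + g ^ 2) by
        linear_combination hsign)
      (show 15 * f ^ 2 = 1 * (g ^ 2 + 16 * f ^ 2) + -1 * (f ^ 2 + g ^ 2) by ring)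
      (show 15 * g ^ 2 = -1 * (g ^ 2 + 16 * f ^ 2) + 16 * (f ^ 2 + g ^ 2) by ring)
    have hf2 := sq_nonneg f
    have hg2 := sq_nonneg g
    have hh2 := sq_nonneg h
    obtain rfl : k = 1 := by
      rw [hf', hg', hh'] at h₃
      interval_cases k <;> omega
    exact false_of_three_dvd hfg (x := e) (y := h) ⟨2 * e ^ 2, by linarith⟩
      ⟨-5 * f ^ 2, by linarith⟩
  · obtain ⟨Q', rfl⟩ := four_dvd_of_mul_eq hP ((mul_comm _ _).trans hmul)
    obtain ⟨e, f, g, h, rfl, rfl, rfl, rfl⟩ := exists_four_factors (a := P) (b := Q') (m := α)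
      (n := β) hP0 (by linarith)
    have he0 : e ≠ 0 := left_ne_zero_of_mul hα0
    obtain ⟨he, hf⟩ := Int.odd_mul.1 hP
    obtain ⟨-, hg⟩ := Int.odd_mul.1 hα
    obtain ⟨e', he'⟩ := Int.exists_sq_eq_of_odd he
    obtain ⟨f', hf'⟩ := Int.exists_sq_eq_of_odd hf
    obtain ⟨g', hg'⟩ := Int.exists_sq_eq_of_odd hg
    have hsign : 5 * (e * g) ^ 2 - (f * h) ^ 2 = 5 * (e * f) ^ 2 - (4 * (g * h)) ^ 2 := by
      refine hsign.resolve_right fun hc => ?_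
      obtain ⟨a, ha⟩ := Int.exists_sq_eq_of_odd hα
      obtain ⟨b, hb⟩ := Int.exists_sq_eq_of_even hβ
      obtain ⟨p, hp⟩ := Int.exists_sq_eq_of_odd hP
      obtain ⟨q, hq⟩ := Int.exists_sq_eq_of_even hQ
      omega
    have hfg : IsCoprime f g := hαβ.symm.of_mul_left_left.of_mul_right_right
    have heh : IsCoprime e h := hαβ.of_mul_left_left.of_mul_right_right
    obtain ⟨k, h₃, h₄, hl, hu', d, hd⟩ := exists_dvd_fifteen_of_mul_eq hfg
      ((hβ5.of_mul_right_right.pow_right).mul_left heh.pow) he0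
      (show 5 * e ^ 2 * (g ^ 2 - f ^ 2) = h ^ 2 * (f ^ 2 - 16 * g ^ 2) by
        linear_combination hsign)
      (show 15 * f ^ 2 = -16 * (g ^ 2 - f ^ 2) + -1 * (f ^ 2 - 16 * g ^ 2) by ring)
      (show 15 * g ^ 2 = -1 * (g ^ 2 - f ^ 2) + -1 * (f ^ 2 - 16 * g ^ 2) by ring)
    have hk : k = 5 ∨ k = -3 := by
      rw [hf', hg', he'] at h₄
      interval_cases k <;> omega
    have hg2 := sq_pos_of_ne_zero (show g ≠ 0 by rintro rfl; simp at hg)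
    have he2 := sq_nonneg e
    have hh2 := sq_nonneg h
    rcases hk with rfl | rfl
    · linarith
    · have h5h : (5 : ℤ) ∣ h := hp.dvd_of_dvd_pow (n := 2) ⟨g ^ 2 - e ^ 2, by linarith⟩
      exact hp.not_isUnit (hβ5.isUnit_of_dvd' dvd_rfl (h5h.mul_left f))

theorem odd_quartic {a b : ℤ} (h : IsCoprime a b) :
    Odd (a ^ 4 - 2 * a ^ 3 * b + 3 * a ^ 2 * b ^ 2 + 2 * a * b ^ 3 + b ^ 4) := by
  have h1 := odd_sq_add_mul_add_sq (h.pow (m := 2) (n := 2))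
  have h2 : Even (2 * (a ^ 2 * b ^ 2 - a ^ 3 * b + a * b ^ 3)) := even_two_mul _
  convert h1.add_even h2 using 1
  ring

theorem isCoprime_quadratic_quartic {a b : ℤ} (h : IsCoprime a b) :
    IsCoprime (a ^ 2 + a * b + b ^ 2)
      (a ^ 4 - 2 * a ^ 3 * b + 3 * a ^ 2 * b ^ 2 + 2 * a * b ^ 3 + b ^ 4) := by
  have hb : IsCoprime (a ^ 2 + a * b + b ^ 2) b := by
    have := (isCoprime_quadratic_mul h 1).of_mul_right_right
    rwa [one_mul] at this
  have h2 := isCoprime_two_of_odd (odd_sq_add_mul_add_sq h)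
  have h4 := ((h2.pow_right (n := 2)).mul_right (hb.pow_right (n := 4))).neg_right
  have h5 := h4.add_mul_left_right (a ^ 2 - 3 * a * b + 5 * b ^ 2)
  ring_nf at h5 ⊢
  exact h5

theorem odd_and_odd_of_quartic_eq_five_mul_sq {a b z : ℤ} (h : IsCoprime a b)
    (hz : a ^ 4 - 2 * a ^ 3 * b + 3 * a ^ 2 * b ^ 2 + 2 * a * b ^ 3 + b ^ 4 = 5 * z ^ 2) :
    Odd a ∧ Odd b := by
  have hzodd : Odd z := by
    have := odd_quartic h
    rw [hz] at this
    exact odd_of_sq (Int.odd_mul.1 this).2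
  obtain ⟨j, hj⟩ := Int.exists_sq_eq_of_odd hzodd
  refine ⟨?_, ?_⟩ <;> by_contra hc <;> rw [Int.not_odd_iff_even] at hc <;>
    obtain ⟨k, rfl⟩ := hc
  · have hb : Odd b := h.odd_or_odd.resolve_left (by simp [← two_mul])
    obtain ⟨i, hi⟩ := Int.exists_sq_eq_of_odd (hb.pow (n := 2))
    obtain ⟨e, he⟩ : Even (k * (3 * k + b)) := by
      rcases Int.even_or_odd k with hk | hk
      · exact hk.mul_right _
      · exact ((Odd.mul (by decide) hk).add_odd hb).mul_left _
    have : 8 * (5 * j - i - e * b ^ 2 - 2 * k ^ 4 + 2 * k ^ 3 * b) = -4 := by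
      linear_combination (-1) * hz - 5 * hj + hi + 4 * b ^ 2 * he
    omega
  · have ha : Odd a := h.odd_or_odd.resolve_right (by simp [← two_mul])
    obtain ⟨i, hi⟩ := Int.exists_sq_eq_of_odd (ha.pow (n := 2))
    obtain ⟨e, he⟩ : Even (k * (3 * k - a)) := by
      rcases Int.even_or_odd k with hk | hk
      · exact hk.mul_right _
      · exact ((Odd.mul (by decide) hk).sub_odd ha).mul_left _
    have : 8 * (5 * j - i - e * a ^ 2 - 2 * k ^ 4 - 2 * k ^ 3 * a) = -4 := by
      linear_combination (-1) * hz - 5 * hj + hi + 4 * a ^ 2 * he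
    omega

theorem add_eq_zero_of_quadratics_eq {a b r s : ℤ} (h : IsCoprime a b) (ha : Odd a) (hb : Odd b)
    (hX : a ^ 2 + a * b + b ^ 2 = r ^ 2) (hY : a ^ 2 - 3 * a * b + b ^ 2 = 5 * s ^ 2) :
    a + b = 0 := by
  obtain ⟨u, hu⟩ := ha.add_odd hb
  obtain ⟨v, hv⟩ := ha.sub_odd hb
  obtain rfl : a = u + v := by omega
  obtain rfl : b = u - v := by omega
  have h5 : (5 : ℤ) ∣ u := by
    refine (Int.prime_iff_natAbs_prime.2 (by norm_num) : Prime (5 : ℤ)).dvd_of_dvd_pow (n := 2) ?_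
    exact ⟨v ^ 2 - s ^ 2, by linear_combination -hY⟩
  obtain ⟨U, rfl⟩ := h5
  have hU : Even U := by
    by_contra hU
    rw [Int.not_even_iff_odd] at hU
    have hv : Even v := by
      have : Odd (5 * U) := Odd.mul (by decide) hU
      simpa [Int.odd_add, this, hU] using ha
    obtain ⟨k, rfl⟩ := hv
    obtain ⟨i, hi⟩ := Int.exists_sq_eq_of_odd hU
    have hr : r ^ 2 = 4 * (k ^ 2 + 150 * i + 18) + 3 := by
      linear_combination (-1) * hX + 75 * hi
    rcases Int.even_or_odd r with ⟨m, rfl⟩ | hr'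
    · have : 4 * (m ^ 2 - (k ^ 2 + 150 * i + 18)) = 3 := by linear_combination hr
      omega
    · obtain ⟨m, hm⟩ := Int.exists_sq_eq_of_odd hr'
      omega
  have hcop : IsCoprime U v := (isCoprime_of_add_sub h).of_mul_left_right
  have := eq_zero_of_sq_sub_five_mul_sq U.natAbs rfl hU hcop (s := s) (r := r)
    (by linarith) (by linarith)
  rw [this]
  ring

theorem add_eq_zero_of_quadratics_mul_quartic_eq_sq {a b w : ℤ} (h : IsCoprime a b)
    (h0 : a * b ≠ 0)
    (hw : (a ^ 2 + a * b + b ^ 2) * (a ^ 2 - 3 * a * b + b ^ 2) *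
      (a ^ 4 - 2 * a ^ 3 * b + 3 * a ^ 2 * b ^ 2 + 2 * a * b ^ 3 + b ^ 4) = w ^ 2) :
    a + b = 0 := by
  have hab := pow_pos (abs_pos.2 h0) 2
  rw [sq_abs] at hab
  set Z := a ^ 4 - 2 * a ^ 3 * b + 3 * a ^ 2 * b ^ 2 + 2 * a * b ^ 3 + b ^ 4 with hZ
  set Y := a ^ 2 - 3 * a * b + b ^ 2 with hY
  have hXpos : 0 < a ^ 2 + a * b + b ^ 2 := by
    have : a ≠ 0 := left_ne_zero_of_mul h0
    nlinarith [sq_nonneg (a + 2 * b), sq_pos_of_ne_zero this]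
  have hZpos : 0 < Z := by nlinarith [sq_nonneg (a ^ 2 - a * b), sq_nonneg (a * b + b ^ 2)]
  have hZodd : Odd Z := odd_quartic h
  have hcop : IsCoprime (a ^ 2 + a * b + b ^ 2) (Y * Z) :=
    (isCoprime_quadratics h).mul_right (isCoprime_quadratic_quartic h)
  rw [mul_assoc] at hw
  obtain ⟨r, hr⟩ := exists_sq_of_mul_eq_sq hcop hXpos.le hw
  have hYZ : 0 ≤ Y * Z := by
    by_contra! hc
    nlinarith [sq_nonneg w]
  obtain ⟨v, hv⟩ := exists_sq_of_mul_eq_sq hcop.symm hYZ (by rw [mul_comm, hw])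
  have hY0 : 0 ≤ Y := nonneg_of_mul_nonneg_left hYZ hZpos
  have hYb : IsCoprime Y b := by
    have := (isCoprime_quadratic_mul h (-3)).of_mul_right_right
    convert this using 1
    rw [hY]
    ring
  have h5p : Prime (5 : ℤ) := Int.prime_iff_natAbs_prime.2 (by norm_num)
  have h16 : 16 * Y = (4 * a - b) * (4 * a - 11 * b) + 5 * b ^ 2 := by rw [hY]; ring
  have hZY : Z = Y * (a ^ 2 + a * b + 5 * b ^ 2) + 4 * b ^ 3 * (4 * a - b) := by
    rw [hY, hZ]; ring
  have hp2 : ∀ p : ℤ, Prime p → p ∣ Z → ¬ p ∣ 2 := fun p hp hpZ hp2 ↦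
    hp.not_isUnit ((isCoprime_two_of_odd hZodd).isUnit_of_dvd' hpZ hp2)
  have hpb : ∀ p : ℤ, Prime p → p ∣ Y → ¬ p ∣ b := fun p hp hpY hpb ↦
    hp.not_isUnit (hYb.isUnit_of_dvd' hpY hpb)
  by_cases h5 : (5 : ℤ) ∣ Y
  · have hm : (5 : ℤ) ∣ 4 * a - b := by
      refine (Int.Prime.dvd_mul' (p := 5) (by norm_num)
        (m := 4 * a - b) (n := 4 * a - 11 * b) ?_).elim id fun hd ↦ ?_ <;> omega
    obtain ⟨m, hm⟩ := hm
    have hYe : Y = 5 * (a ^ 2 - 5 * a * m + 5 * m ^ 2) := by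
      obtain rfl : b = 4 * a - 5 * m := by linarith
      rw [hY]; ring
    set Y' := a ^ 2 - 5 * a * m + 5 * m ^ 2 with hY'
    have hZe : Z = 5 * (Y' * (a ^ 2 + a * b + 5 * b ^ 2) + 4 * b ^ 3 * m) := by
      rw [hZY, hYe, hm]; ring
    set Z' := Y' * (a ^ 2 + a * b + 5 * b ^ 2) + 4 * b ^ 3 * m with hZ'
    have hcop' : IsCoprime Y' Z' := by
      refine isCoprime_of_prime_dvd (fun hc ↦ by rw [hZe, hc.2] at hZpos; simp at hZpos)
        fun p hp hpY hpZ ↦ ?_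
      have hpb' := hpb p hp (hYe ▸ hpY.mul_left 5)
      have hp2' := hp2 p hp (hZe ▸ hpZ.mul_left 5)
      have h1 : p ∣ 2 ^ 2 * b ^ 3 * m := by
        rw [show 2 ^ 2 * b ^ 3 * m = Z' - Y' * (a ^ 2 + a * b + 5 * b ^ 2) by rw [hZ']; ring]
        exact dvd_sub hpZ (hpY.mul_right _)
      have hpm : p ∣ m := (hp.dvd_or_dvd h1).resolve_left fun hd ↦
        (hp.dvd_or_dvd hd).elim (fun hd ↦ hp2' (hp.dvd_of_dvd_pow hd))
          (fun hd ↦ hpb' (hp.dvd_of_dvd_pow hd))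
      have hpa : p ∣ a := by
        refine hp.dvd_of_dvd_pow (n := 2) ?_
        rw [show a ^ 2 = Y' + m * (5 * a - 5 * m) by rw [hY']; ring]
        exact dvd_add hpY (hpm.mul_right _)
      apply hpb'
      rw [show b = 4 * a - 5 * m by linarith]
      exact dvd_sub (hpa.mul_left 4) (hpm.mul_left 5)
    obtain ⟨x, rfl⟩ : (5 : ℤ) ∣ v := h5p.dvd_of_dvd_pow (n := 2) (hv ▸ h5.mul_right Z)
    have hx : Y' * Z' = x ^ 2 := by
      rw [hYe, hZe] at hv
      linarith
    obtain ⟨s, hs⟩ := exists_sq_of_mul_eq_sq hcop' (by linarith) hx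
    obtain ⟨z, hz⟩ := exists_sq_of_mul_eq_sq hcop'.symm (by linarith) (by rw [mul_comm, hx])
    obtain ⟨ha, hb⟩ := odd_and_odd_of_quartic_eq_five_mul_sq h (z := z) (by rw [← hz, ← hZe])
    exact add_eq_zero_of_quadratics_eq h ha hb hr (s := s) (by rw [← hs, ← hYe])
  · have hcop' : IsCoprime Z Y := by
      refine isCoprime_of_prime_dvd (fun hc ↦ hZpos.ne' hc.1) fun p hp hpZ hpY ↦ ?_
      have h1 : p ∣ 2 ^ 4 * 5 * b ^ 5 := by
        rw [show 2 ^ 4 * 5 * b ^ 5 =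
            Y * (64 * b ^ 3 + (4 * a - 11 * b) * (a ^ 2 + a * b + 5 * b ^ 2)) * 4 -
              Z * ((4 * a - 11 * b) * 4) by
          linear_combination (-(16 * b ^ 3)) * h16 + 4 * (4 * a - 11 * b) * hZY]
        exact dvd_sub ((hpY.mul_right _).mul_right _) (hpZ.mul_right _)
      rcases hp.dvd_or_dvd h1 with hd | hd
      · rcases hp.dvd_or_dvd hd with hd | hd
        · exact hp2 p hp hpZ (hp.dvd_of_dvd_pow hd)
        · exact h5 ((hp.associated_of_dvd h5p hd).dvd_iff_dvd_left.1 hpY)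
      · exact hpb p hp hpY (hp.dvd_of_dvd_pow hd)
    obtain ⟨z, hz⟩ := exists_sq_of_mul_eq_sq hcop' hZpos.le (by rw [mul_comm, hv])
    exact absurd (mul_eq_zero_of_quartic_eq_sq h hz) h0

theorem Rat.num_eq_mul_den (r : ℚ) : (r.num : ℚ) = r * ((r.den : ℤ) : ℚ) := by
  simp [Rat.mul_den_eq_num]

theorem exists_int_sq_of_intCast_eq_sq {n : ℤ} {q : ℚ} (h : (n : ℚ) = q ^ 2) :
    ∃ m : ℤ, n = m ^ 2 :=
  (Rat.isSquare_intCast_iff.1 ⟨q, by rw [h, sq]⟩).imp fun m hm ↦ by rw [hm, sq]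

theorem Rat.eq_zero_of_num_mul_den {r : ℚ} (h : r.num * (r.den : ℤ) = 0) : r = 0 := by
  simpa using h

theorem Rat.eq_zero_of_quartic_eq_sq₁ {r s : ℚ}
    (h : s ^ 2 = r ^ 4 - 2 * r ^ 3 - r ^ 2 - 2 * r + 1) : r = 0 := by
  obtain ⟨m, hm⟩ := exists_int_sq_of_intCast_eq_sq
    (n := (r.num ^ 2 + r.num * r.den + r.den ^ 2) * (r.num ^ 2 - 3 * r.num * r.den + r.den ^ 2))
    (q := s * ((r.den : ℤ) : ℚ) ^ 2) (by
      push_cast [r.num_eq_mul_den]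
      linear_combination (-(r.den : ℚ) ^ 4) * h)
  exact Rat.eq_zero_of_num_mul_den
    (mul_eq_zero_of_quadratics_mul_eq_sq (Rat.isCoprime_num_den r) hm)

theorem Rat.eq_zero_of_quartic_eq_sq₂ {r s : ℚ}
    (h : s ^ 2 = r ^ 4 - 2 * r ^ 3 + 3 * r ^ 2 + 2 * r + 1) : r = 0 := by
  obtain ⟨m, hm⟩ := exists_int_sq_of_intCast_eq_sq
    (n := r.num ^ 4 - 2 * r.num ^ 3 * r.den + 3 * r.num ^ 2 * r.den ^ 2 +
      2 * r.num * r.den ^ 3 + r.den ^ 4)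
    (q := s * ((r.den : ℤ) : ℚ) ^ 2) (by
      push_cast [r.num_eq_mul_den]
      linear_combination (-(r.den : ℚ) ^ 4) * h)
  exact Rat.eq_zero_of_num_mul_den
    (mul_eq_zero_of_quartic_eq_sq (Rat.isCoprime_num_den r) hm)

theorem Rat.eq_neg_one_of_quartic_eq_sq_mul_quartic {r s : ℚ} (hr : r ≠ 0)
    (h : r ^ 4 - 2 * r ^ 3 + 3 * r ^ 2 + 2 * r + 1 =
      s ^ 2 * (r ^ 4 - 2 * r ^ 3 - r ^ 2 - 2 * r + 1)) : r = -1 := by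
  obtain ⟨m, hm⟩ := exists_int_sq_of_intCast_eq_sq
    (n := (r.num ^ 2 + r.num * r.den + r.den ^ 2) * (r.num ^ 2 - 3 * r.num * r.den + r.den ^ 2) *
      (r.num ^ 4 - 2 * r.num ^ 3 * r.den + 3 * r.num ^ 2 * r.den ^ 2 +
        2 * r.num * r.den ^ 3 + r.den ^ 4))
    (q := s * (r ^ 4 - 2 * r ^ 3 - r ^ 2 - 2 * r + 1) * ((r.den : ℤ) : ℚ) ^ 4) (by
      push_cast [r.num_eq_mul_den]
      linear_combination (r ^ 4 - 2 * r ^ 3 - r ^ 2 - 2 * r + 1) * (r.den : ℚ) ^ 8 * h)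
  have h0 := add_eq_zero_of_quadratics_mul_quartic_eq_sq (Rat.isCoprime_num_den r)
    (fun h0 ↦ hr (Rat.eq_zero_of_num_mul_den h0)) hm
  have h1 : (r + 1) * (r.den : ℚ) = 0 := by
    have : ((r.num + r.den : ℤ) : ℚ) = 0 := by rw [h0]; rfl
    push_cast [r.num_eq_mul_den] at this
    linear_combination this
  have h2 := (mul_eq_zero.1 h1).resolve_right (by simp)
  linarith

theorem Rat.relation_of_quartic₁ {T N A B : ℚ}
    (h₁ : A ^ 2 * T + 2 * A * B = T ^ 3 - 2 * T * N - 2 * (T ^ 2 - N) - T - 2)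
    (h₀ : B ^ 2 - A ^ 2 * N = 2 * T * N - (T ^ 2 - N) * N + N + 1) :
    N = 1 ∨ (N + 1) * (T - 1) = -1 := by
  obtain ⟨a, rfl⟩ : ∃ a, A = a + T := ⟨A - T, by ring⟩
  obtain ⟨s, rfl⟩ : ∃ s, B = s - N := ⟨B + N, by ring⟩
  set k := -2 - 2 * a with hk
  obtain ⟨l, hl⟩ : ∃ l, l = -1 - a ^ 2 - 2 * s + k * T := ⟨_, rfl⟩
  have e₀ : 1 - s ^ 2 = l * N := by rw [hl, hk]; linear_combination -h₀
  have e₁ : -2 - 2 * a * s = k * N - l * T := by rw [hl, hk]; linear_combination -h₁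
  have hkl : k = 0 ∨ l = 0 := by
    by_contra! hc
    have hx : k * (-l / k) + l = 0 := by field_simp [hc.1]; ring
    have := Rat.eq_zero_of_quartic_eq_sq₁ (r := -l / k) (s := (-l / k) ^ 2 + a * (-l / k) + s) (by
      generalize -l / k = x at hx
      linear_combination (-(x ^ 2 - T * x + N)) * hx - e₀ - e₁ * x + x ^ 2 * hl + x ^ 3 * hk)
    simp [hc] at this
  rcases hkl with h | h
  · obtain rfl : a = -1 := by linarith
    have hs : s + 1 ≠ 0 := by
      intro hs
      obtain rfl : s = -1 := by linarith
      norm_num [hk] at hl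
      norm_num [hk, hl] at e₁
    right
    have hN : N = (s - 1) / 2 := by
      apply mul_left_cancel₀ hs
      rw [hl, h] at e₀
      linarith
    have hT : T = (s - 1) / (s + 1) := by
      rw [eq_div_iff hs]
      rw [hl, h] at e₁
      linarith
    rw [hN, hT]
    field_simp
    ring
  · have ha : 1 + a ≠ 0 := by
      intro ha
      obtain rfl : a = -1 := by linarith
      norm_num [hk, h] at e₁ hl
      nlinarith
    rw [h] at hl e₀ e₁
    have hs : (s - 1) * (s + 1) = 0 := by linarith
    rcases mul_eq_zero.1 hs with hs | hs
    · obtain rfl : s = 1 := by linarith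
      left
      apply mul_left_cancel₀ ha
      linarith
    · obtain rfl : s = -1 := by linarith
      right
      have hN : N = (1 - a) / (1 + a) := by
        rw [eq_div_iff ha]
        linarith
      have hT : T = (1 - a) / 2 := by
        apply mul_left_cancel₀ ha
        linarith
      rw [hN, hT]
      field_simp
      ring

theorem Rat.relation_of_quartic₂ {T N A B : ℚ}
    (h₁ : A ^ 2 * T + 2 * A * B = T ^ 3 - 2 * T * N - 2 * (T ^ 2 - N) + 3 * T + 2)
    (h₀ : B ^ 2 - A ^ 2 * N = 2 * T * N - (T ^ 2 - N) * N - 3 * N + 1) :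
    N = -1 ∨ (N - 1) * (T - 1) = 1 := by
  obtain ⟨a, rfl⟩ : ∃ a, A = a + T := ⟨A - T, by ring⟩
  obtain ⟨s, rfl⟩ : ∃ s, B = s - N := ⟨B + N, by ring⟩
  set k := -2 - 2 * a with hk
  obtain ⟨l, hl⟩ : ∃ l, l = 3 - a ^ 2 - 2 * s + k * T := ⟨_, rfl⟩
  have e₀ : 1 - s ^ 2 = l * N := by rw [hl, hk]; linear_combination -h₀
  have e₁ : 2 - 2 * a * s = k * N - l * T := by rw [hl, hk]; linear_combination -h₁
  have hkl : k = 0 ∨ l = 0 := by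
    by_contra! hc
    have hx : k * (-l / k) + l = 0 := by field_simp [hc.1]; ring
    have := Rat.eq_zero_of_quartic_eq_sq₂ (r := -l / k) (s := (-l / k) ^ 2 + a * (-l / k) + s) (by
      generalize -l / k = x at hx
      linear_combination (-(x ^ 2 - T * x + N)) * hx - e₀ - e₁ * x + x ^ 2 * hl + x ^ 3 * hk)
    simp [hc] at this
  rcases hkl with h | h
  · obtain rfl : a = -1 := by linarith
    have hs : s - 1 ≠ 0 := by
      intro hs
      obtain rfl : s = 1 := by linarith
      norm_num [hk] at hl
      norm_num [hk, hl] at e₁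
    right
    have hN : N = (s + 1) / 2 := by
      apply mul_left_cancel₀ hs
      rw [hl, h] at e₀
      linarith
    have hT : T = (s + 1) / (s - 1) := by
      rw [eq_div_iff hs]
      rw [hl, h] at e₁
      linarith
    rw [hN, hT]
    field_simp
    ring
  · have ha : 1 + a ≠ 0 := by
      intro ha
      obtain rfl : a = -1 := by linarith
      norm_num [hk, h] at e₁ hl
      nlinarith
    rw [h] at hl e₀ e₁
    have hs : (s - 1) * (s + 1) = 0 := by linarith
    rcases mul_eq_zero.1 hs with hs | hs
    · obtain rfl : s = 1 := by linarith
      right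
      have hN : N = (a - 1) / (1 + a) := by
        rw [eq_div_iff ha]
        linarith
      have hT : T = (1 - a) / 2 := by
        apply mul_left_cancel₀ ha
        linarith
      rw [hN, hT]
      field_simp
      ring
    · obtain rfl : s = -1 := by linarith
      left
      apply mul_left_cancel₀ ha
      linarith

section QuadraticField

variable {K : Type*} [Field K] [CharZero K]

theorem eq_zero_of_add_mul_eq_zero {x : K} (hx : ∀ q : ℚ, (q : K) ≠ x) {p q : ℚ}
    (h : (p : K) + q * x = 0) : p = 0 ∧ q = 0 := by
  have hq : q = 0 := by
    by_contra hq
    apply hx (-p / q)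
    have : (q : K) ≠ 0 := by exact_mod_cast hq
    push_cast
    field_simp
    linear_combination -h
  subst hq
  simpa using h

theorem exists_eq_add_mul_of_finrank_eq_two (hdeg : Module.finrank ℚ K = 2) {x : K}
    (hx : ∀ q : ℚ, (q : K) ≠ x) (y : K) : ∃ p q : ℚ, y = p + q * x := by
  have hli : LinearIndependent ℚ ![(1 : K), x] := by
    rw [LinearIndependent.pair_iff]
    intro p q h
    simp only [Rat.smul_def, mul_one] at h
    exact eq_zero_of_add_mul_eq_zero hx h
  have : FiniteDimensional ℚ K := .of_finrank_pos (by simp [hdeg])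
  have hspan := hli.span_eq_top_of_card_eq_finrank' (by simp [hdeg])
  have hy : y ∈ Submodule.span ℚ (Set.range ![(1 : K), x]) := by rw [hspan]; trivial
  simp only [Matrix.range_cons, Matrix.range_empty, Set.union_empty, Set.singleton_union] at hy
  obtain ⟨p, q, h⟩ := Submodule.mem_span_pair.1 hy
  exact ⟨p, q, by rw [← h]; simp [Rat.smul_def]⟩

theorem eq_neg_one_of_quartics_eq_sq (hdeg : Module.finrank ℚ K = 2) {t y z : K} (ht : t ≠ 0)
    (hy : y ^ 2 = t ^ 4 - 2 * t ^ 3 - t ^ 2 - 2 * t + 1)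
    (hz : z ^ 2 = t ^ 4 - 2 * t ^ 3 + 3 * t ^ 2 + 2 * t + 1) : t = -1 := by
  by_cases hrat : ∃ q : ℚ, (q : K) = t
  · obtain ⟨r, rfl⟩ := hrat
    have hr : r ≠ 0 := by exact_mod_cast ht
    by_cases hyrat : ∃ q : ℚ, (q : K) = y
    · obtain ⟨s, rfl⟩ := hyrat
      exact absurd (Rat.eq_zero_of_quartic_eq_sq₁ (s := s) (by exact_mod_cast hy)) hr
    · push Not at hyrat
      obtain ⟨B, A, rfl⟩ := exists_eq_add_mul_of_finrank_eq_two hdeg hyrat z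
      obtain ⟨h₀, h₁⟩ := eq_zero_of_add_mul_eq_zero hyrat
        (p := B ^ 2 + A ^ 2 * (r ^ 4 - 2 * r ^ 3 - r ^ 2 - 2 * r + 1) -
          (r ^ 4 - 2 * r ^ 3 + 3 * r ^ 2 + 2 * r + 1)) (q := 2 * A * B) (by
          push_cast
          linear_combination hz - (A : K) ^ 2 * hy)
      rcases mul_eq_zero.1 h₁ with hA | rfl
      · obtain rfl : A = 0 := by linarith
        exact absurd (Rat.eq_zero_of_quartic_eq_sq₂ (s := B) (by linarith)) hr
      · have := Rat.eq_neg_one_of_quartic_eq_sq_mul_quartic hr (s := A) (by linarith)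
        rw [this]
        norm_num
  · exfalso
    push Not at hrat
    have hspan := exists_eq_add_mul_of_finrank_eq_two hdeg hrat
    obtain ⟨M, T, hT⟩ := hspan (t ^ 2)
    obtain ⟨N, rfl⟩ : ∃ N, M = -N := ⟨-M, by ring⟩
    push_cast at hT
    have ht3 : t ^ 3 = (T ^ 2 - N) * t - T * N := by linear_combination (t + T) * hT
    have ht4 : t ^ 4 = (T ^ 3 - 2 * T * N) * t - (T ^ 2 - N) * N := by
      linear_combination t * ht3 + (T ^ 2 - N : K) * hT
    obtain ⟨B, A, rfl⟩ := hspan y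
    obtain ⟨D, C, rfl⟩ := hspan z
    obtain ⟨h₀, h₁⟩ := eq_zero_of_add_mul_eq_zero hrat
      (p := B ^ 2 - A ^ 2 * N - (2 * T * N - (T ^ 2 - N) * N + N + 1))
      (q := A ^ 2 * T + 2 * A * B - (T ^ 3 - 2 * T * N - 2 * (T ^ 2 - N) - T - 2)) (by
        push_cast
        linear_combination hy + ht4 - 2 * ht3 - hT - (A : K) ^ 2 * hT)
    obtain ⟨k₀, k₁⟩ := eq_zero_of_add_mul_eq_zero hrat
      (p := D ^ 2 - C ^ 2 * N - (2 * T * N - (T ^ 2 - N) * N - 3 * N + 1))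
      (q := C ^ 2 * T + 2 * C * D - (T ^ 3 - 2 * T * N - 2 * (T ^ 2 - N) + 3 * T + 2)) (by
        push_cast
        linear_combination hz + ht4 - 2 * ht3 + 3 * hT - (C : K) ^ 2 * hT)
    have hN : N ≠ 0 := by
      rintro rfl
      apply hrat T
      apply mul_left_cancel₀ ht
      push_cast at hT
      linear_combination -hT
    rcases Rat.relation_of_quartic₁ (sub_eq_zero.1 h₁) (sub_eq_zero.1 h₀) with h | h <;>
      rcases Rat.relation_of_quartic₂ (sub_eq_zero.1 k₁) (sub_eq_zero.1 k₀) with h' | h'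
    · norm_num [h] at h'
    · norm_num [h] at h'
    · norm_num [h'] at h
    · have hm : N * (T - 1) = 0 := by linarith
      rw [(mul_eq_zero.1 hm).resolve_left hN] at h
      norm_num at h

end QuadraticField

theorem HasPreperiodicType.sq_eq_of_one_two {K : Type*} [Field K] {c α : K}
    (h : HasPreperiodicType c 1 2 α) : ∃ p : K, c = p - p ^ 2 ∧ α ^ 2 = p ^ 2 - 2 * p := by
  obtain ⟨⟨hp, -⟩, hne⟩ := h
  simp only [fc, Function.iterate_succ_apply, Function.iterate_zero_apply, Nat.reduceAdd,
    Nat.reduceSub] at hp hne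
  set u := α ^ 2 + c with hu
  set p := u ^ 2 + c with hp'
  have hup : u = -p := by
    have : (u - p) * (u + p) = 0 := by linear_combination hp' - hp
    have := (mul_eq_zero.1 this).resolve_left fun h ↦ hne (sub_eq_zero.1 h).symm
    exact eq_neg_of_add_eq_zero_left this
  exact ⟨p, by linear_combination hp, by linear_combination hup - hu - hp⟩

theorem HasPreperiodicType.sq_eq_of_two_two {K : Type*} [Field K] {c β : K}
    (h : HasPreperiodicType c 2 2 β) :
    ∃ q : K, c = -q ^ 2 - q - 1 ∧ β ^ 2 = q ^ 2 + 1 ∧ 2 * q ≠ -1 := by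
  obtain ⟨⟨hp, hper⟩, hne⟩ := h
  have hper := hper 1 le_rfl one_lt_two
  simp only [fc, Function.iterate_succ_apply, Function.iterate_zero_apply, Nat.reduceAdd,
    Nat.reduceSub] at hp hper hne
  set v := β ^ 2 + c with hv
  set r := v ^ 2 + c with hr
  set q := r ^ 2 + c with hq
  have hvq : v = -q := by
    have : (v - q) * (v + q) = 0 := by linear_combination hr - hp
    have := (mul_eq_zero.1 this).resolve_left fun h ↦ hne (sub_eq_zero.1 h).symm
    exact eq_neg_of_add_eq_zero_left this
  have hrq : q + r + 1 = 0 := by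
    have : (q - r) * (q + r + 1) = 0 := by linear_combination hp + hq
    exact (mul_eq_zero.1 this).resolve_left fun h ↦ hper (sub_eq_zero.1 h)
  refine ⟨q, by linear_combination hp + hrq, by linear_combination hvq - hv - hp - hrq, ?_⟩
  intro h2
  exact hper (by linear_combination h2 - hrq)

theorem no_type_1_2_with_type_2_2 {K : Type*} [Field K] [NumberField K]
    (hdeg : Module.finrank ℚ K = 2) (c : K) :
    ¬∃ α β : K, HasPreperiodicType c 1 2 α ∧ HasPreperiodicType c 2 2 β := by
  rintro ⟨α, β, hα, hβ⟩
  obtain ⟨p, hcp, hα⟩ := hα.sq_eq_of_one_two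
  obtain ⟨q, hcq, hβ, hq⟩ := hβ.sq_eq_of_two_two
  obtain ⟨t, ht⟩ : ∃ t, t = p + q := ⟨_, rfl⟩
  have hpq : t * (p - q - 1) = 1 := by rw [ht]; linear_combination hcp - hcq
  have hp : 2 * t * p = t ^ 2 + t + 1 := by linear_combination hpq - t * ht
  have hqt : 2 * t * q = t ^ 2 - t - 1 := by linear_combination -hpq - t * ht
  have h1 : t = -1 := eq_neg_one_of_quartics_eq_sq hdeg (left_ne_zero_of_mul_eq_one hpq)
    (y := 2 * t * α) (z := 2 * t * β)
    (by linear_combination 4 * t ^ 2 * hα + (2 * t * p + t ^ 2 + t + 1 - 4 * t) * hp)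
    (by linear_combination 4 * t ^ 2 * hβ + (2 * t * q + t ^ 2 - t - 1) * hqt)
  rw [h1] at hqt
  exact hq (by linear_combination -hqt)
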